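/- arXiv:2403.06882 — 8 statements merged into one kernel-verified Lean document; each statement's English description precedes it below -/
import Mathlib

section
/- Let η ≠ 0 and β be complex numbers. Define functions F_n on pairs of n-tuples of complex numbers recursively by F_1((v),(u)|β) = g(u,v)(e^β − 1) and, for n ≥ 2, F_n(v̄,ū|β) = Σ_{j=1}^{n} g(v_n,u_j)·[ f(u_j,ū_j) f(v̄_n,u_j) − e^β f(ū_j,u_j) f(u_j,v̄_n) ]·F_{n−1}(v̄_n,ū_j|β), where ū_j denotes ū with the entry u_j removed and v̄_n denotes v̄ with v_n removed. Then for any n ≥ 1, if u_k = u_1 + (k−1)η for k = 1,…,n and v_1,…,v_n are pairwise distinct complex numbers, each distinct from every u_k, one has F_n(v̄,ū|β) = (e^β − 1) · n! · g(u_1,v̄) g(u_n,v̄) · Σ_{k=0}^{n−1} binom(n−1,k) e^{kβ} (−1)^{n−1−k} / g(u_{k+1},v̄). -/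
open Finset

noncomputable section

/-- `g(u,v) = η/(u−v)` -/
def gg (η u v : ℂ) : ℂ := η / (u - v)

/-- `f(u,v) = (u−v+η)/(u−v)` -/
def ff (η u v : ℂ) : ℂ := (u - v + η) / (u - v)

/-- The inverse of the product of `g(y, v_j)`, written as a polynomial in `y`. -/
def invProd (η : ℂ) {n : ℕ} (v : Fin n → ℂ) (y : ℂ) : ℂ := ∏ j, (y - v j) / η

/-- The alternating binomial transform of `p` with weight `t`. -/
def altBinomSum (t : ℂ) (n : ℕ) (p : ℕ → ℂ) : ℂ :=
  ∑ k ∈ range (n + 1), (n.choose k : ℂ) * t ^ k * (-1) ^ (n + k) * p k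

lemma altBinomSum_succ_mul_linear (t q : ℂ) (n : ℕ) (p : ℕ → ℂ) :
    altBinomSum t (n + 1) (fun k => (q + k) * p k) =
      (q + (n + 1)) * t * altBinomSum t n (fun k => p (k + 1)) - q * altBinomSum t n p := by
  have hlast : altBinomSum t n p =
      ∑ k ∈ range (n + 2), (n.choose k : ℂ) * t ^ k * (-1) ^ (n + k) * p k := by
    rw [sum_range_succ _ (n + 1)]
    simp [altBinomSum]
  rw [hlast, sum_range_succ', altBinomSum, sum_range_succ', altBinomSum, mul_add, mul_sum,
    mul_sum, ← sub_sub, ← sum_sub_distrib, sub_eq_add_neg]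
  congr 1
  · refine sum_congr rfl fun k _ => ?_
    have h1 : ((n : ℂ) + 1) * n.choose k = (n + 1).choose (k + 1) * (k + 1) := by
      exact_mod_cast Nat.add_one_mul_choose_eq n k
    have h2 : ((n + 1).choose (k + 1) : ℂ) = n.choose k + n.choose (k + 1) := by
      exact_mod_cast Nat.choose_succ_succ n k
    have h3 : ((-1 : ℂ)) ^ (n + 1 + (k + 1)) = (-1) ^ (n + k) := by ring
    have h4 : ((-1 : ℂ)) ^ (n + (k + 1)) = -(-1) ^ (n + k) := by ring
    rw [h3, h4]
    push_cast
    linear_combination (t ^ (k + 1) * (-1) ^ (n + k) * p (k + 1)) * (q * h2 - h1)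
  · simp
    ring

lemma prod_gg_eq_inv (η : ℂ) {n : ℕ} (v : Fin n → ℂ) (y : ℂ) :
    ∏ j, gg η y (v j) = (invProd η v y)⁻¹ := by
  simp [invProd, gg]

lemma invProd_ne_zero {η : ℂ} (hη : η ≠ 0) {n : ℕ} {v : Fin n → ℂ} {y : ℂ}
    (h : ∀ j, v j ≠ y) : invProd η v y ≠ 0 :=
  prod_ne_zero_iff.2 fun j _ => div_ne_zero (sub_ne_zero.2 (h j).symm) hη

lemma prod_ff_left {η : ℂ} (hη : η ≠ 0) {n : ℕ} (v : Fin n → ℂ) (y : ℂ) :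
    ∏ j, ff η y (v j) = invProd η v (y + η) / invProd η v y := by
  rw [invProd, invProd, ← prod_div_distrib]
  refine prod_congr rfl fun j _ => ?_
  rw [ff, div_div_div_cancel_right₀ hη, sub_add_eq_add_sub]

lemma prod_ff_right {η : ℂ} (hη : η ≠ 0) {n : ℕ} (v : Fin n → ℂ) (y : ℂ) :
    ∏ j, ff η (v j) (y + η) = invProd η v y / invProd η v (y + η) := by
  rw [invProd, invProd, ← prod_div_distrib]
  refine prod_congr rfl fun j _ => ?_
  rw [ff, div_div_div_cancel_right₀ hη, ← neg_div_neg_eq]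
  congr 1 <;> ring

lemma prod_range_add_two_div_add_one (m : ℕ) :
    ∏ k ∈ range m, ((k : ℂ) + 2) / (k + 1) = m + 1 := by
  induction m with
  | zero => simp
  | succ m ih =>
    have : (m : ℂ) + 1 ≠ 0 := by exact_mod_cast m.succ_ne_zero
    rw [prod_range_succ, ih]
    push_cast
    field_simp
    ring

lemma ff_of_sub_eq {η : ℂ} (hη : η ≠ 0) {a b : ℂ} (k : ℕ) (h : a - b = (k + 1) * η) :
    ff η a b = (k + 2) / (k + 1) := by
  have : (k : ℂ) + 1 ≠ 0 := by exact_mod_cast k.succ_ne_zero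
  rw [ff, h]
  field_simp
  ring

/-- The arithmetic progression `x, x + η, …` of length `n`. -/
def arith (η x : ℂ) (n : ℕ) : Fin n → ℂ := fun k => x + (k : ℕ) * η

lemma arith_comp_castSucc (η x : ℂ) (n : ℕ) :
    arith η x (n + 1) ∘ Fin.castSucc = arith η x n := rfl

lemma arith_comp_succ (η x : ℂ) (n : ℕ) :
    arith η x (n + 1) ∘ Fin.succ = arith η (x + η) n := by
  ext k
  simp [arith]
  ring

lemma prod_ff_arith_last {η : ℂ} (hη : η ≠ 0) (x : ℂ) (n : ℕ) :
    ∏ k : Fin n, ff η (arith η x (n + 1) (Fin.last n))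
      (arith η x (n + 1) ((Fin.last n).succAbove k)) = n + 1 := by
  rw [← prod_range_add_two_div_add_one n, ← Fin.prod_univ_eq_prod_range
    (fun k => ((k : ℂ) + 2) / (k + 1)) n, ← Equiv.prod_comp Fin.revPerm]
  refine prod_congr rfl fun k _ => ff_of_sub_eq hη _ ?_
  have h : (n : ℂ) = ((n - (k + 1) : ℕ) : ℂ) + (k + 1) := by
    have := k.2
    exact_mod_cast (show n = (n - (k + 1)) + (k + 1) by omega)
  simp only [Fin.succAbove_last, arith, Fin.revPerm_apply, Fin.val_last, Fin.val_castSucc,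
    Fin.val_rev]
  linear_combination η * h

lemma prod_ff_arith_zero {η : ℂ} (hη : η ≠ 0) (x : ℂ) (n : ℕ) :
    ∏ k : Fin n, ff η (arith η x (n + 1) ((0 : Fin (n + 1)).succAbove k))
      (arith η x (n + 1) 0) = n + 1 := by
  rw [← prod_range_add_two_div_add_one n, ← Fin.prod_univ_eq_prod_range
    (fun k => ((k : ℂ) + 2) / (k + 1)) n]
  refine prod_congr rfl fun k _ => ff_of_sub_eq hη _ ?_
  simp [arith]

lemma prod_ff_arith_eq_zero_of_ne_last (η x : ℂ) {n : ℕ} {j : Fin (n + 1)}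
    (hj : j ≠ Fin.last n) :
    ∏ k : Fin n, ff η (arith η x (n + 1) j) (arith η x (n + 1) (j.succAbove k)) = 0 := by
  have hlt : (j : ℕ) < n := Fin.val_lt_last hj
  obtain ⟨k, hk⟩ := Fin.exists_succAbove_eq (x := (⟨j + 1, by omega⟩ : Fin (n + 1))) (y := j)
    (by simp [Fin.ext_iff])
  refine prod_eq_zero (mem_univ k) ?_
  rw [hk, ff, div_eq_zero_iff]
  left
  simp only [arith]
  push_cast
  ring

lemma prod_ff_arith_eq_zero_of_ne_zero (η x : ℂ) {n : ℕ} {j : Fin (n + 1)} (hj : j ≠ 0) :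
    ∏ k : Fin n, ff η (arith η x (n + 1) (j.succAbove k)) (arith η x (n + 1) j) = 0 := by
  obtain ⟨i, rfl⟩ := Fin.exists_succ_eq.2 hj
  obtain ⟨k, hk⟩ := Fin.exists_succAbove_eq (x := i.castSucc) (y := i.succ)
    (by simp [Fin.ext_iff])
  refine prod_eq_zero (mem_univ k) ?_
  rw [hk, ff, div_eq_zero_iff]
  left
  simp only [arith, Fin.val_castSucc, Fin.val_succ]
  push_cast
  ring

lemma invProd_succ (η : ℂ) {n : ℕ} (v : Fin (n + 1) → ℂ) (y : ℂ) :
    invProd η v y = invProd η (v ∘ Fin.castSucc) y * ((y - v (Fin.last n)) / η) := by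
  simp only [invProd, Fin.prod_univ_castSucc, Function.comp_apply]

lemma recursion_on_arith (η β : ℂ) (hη : η ≠ 0)
    (F : ∀ n : ℕ, (Fin n → ℂ) → (Fin n → ℂ) → ℂ)
    (hF1 : ∀ v u : Fin 1 → ℂ, F 1 v u = gg η (u 0) (v 0) * (Complex.exp β - 1))
    (hFrec : ∀ (n : ℕ) (v u : Fin (n + 2) → ℂ),
      F (n + 2) v u = ∑ j : Fin (n + 2),
        gg η (v (Fin.last (n + 1))) (u j) *
          ((∏ k : Fin (n + 1), ff η (u j) (u (j.succAbove k))) *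
              (∏ k : Fin (n + 1), ff η (v k.castSucc) (u j)) -
            Complex.exp β * (∏ k : Fin (n + 1), ff η (u (j.succAbove k)) (u j)) *
              (∏ k : Fin (n + 1), ff η (u j) (v k.castSucc))) *
          F (n + 1) (v ∘ Fin.castSucc) (u ∘ j.succAbove))
    (N : ℕ) (x : ℂ) (v : Fin (N + 1) → ℂ)
    (hv : ∀ j, ∀ k ≤ N, v j ≠ x + (k : ℕ) * η) :
    F (N + 1) v (arith η x (N + 1)) =
      (Complex.exp β - 1) * (Nat.factorial (N + 1) : ℂ) *
        altBinomSum (Complex.exp β) N (fun k => invProd η v (x + k * η)) /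
          (invProd η v x * invProd η v (x + N * η)) := by
  induction N generalizing x with
  | zero =>
    have hx : x - v 0 ≠ 0 := sub_ne_zero.2 (by simpa using (hv 0 0 le_rfl).symm)
    rw [hF1]
    simp [arith, altBinomSum, invProd, gg]
    field_simp
  | succ N ih =>
    have hsplit : F (N + 2) v (arith η x (N + 2)) =
        gg η (v (Fin.last (N + 1))) (x + N * η + η) * (N + 2) *
            (∏ k : Fin (N + 1), ff η (v k.castSucc) (x + N * η + η)) *
            F (N + 1) (v ∘ Fin.castSucc) (arith η x (N + 1)) -
          gg η (v (Fin.last (N + 1))) x * Complex.exp β * (N + 2) *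
            (∏ k : Fin (N + 1), ff η x (v k.castSucc)) *
            F (N + 1) (v ∘ Fin.castSucc) (arith η (x + η) (N + 1)) := by
      have hlast : arith η x (N + 2) (Fin.last (N + 1)) = x + N * η + η := by
        simp [arith]
        ring
      have hzero : arith η x (N + 2) 0 = x := by simp [arith]
      rw [hFrec]
      simp only [mul_sub, sub_mul, sum_sub_distrib]
      congr 1
      · rw [sum_eq_single (Fin.last (N + 1))
          (fun j _ hj => by rw [prod_ff_arith_eq_zero_of_ne_last η x hj]; simp) (by simp),
          prod_ff_arith_last hη, hlast, Fin.succAbove_last, arith_comp_castSucc]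
        push_cast
        ring
      · rw [sum_eq_single 0
          (fun j _ hj => by rw [prod_ff_arith_eq_zero_of_ne_zero η x hj]; simp) (by simp),
          prod_ff_arith_zero hη, hzero, Fin.succAbove_zero, arith_comp_succ]
        push_cast
        ring
    set w := v ∘ Fin.castSucc with hw
    have hne : ∀ k ≤ N + 1, invProd η w (x + (k : ℕ) * η) ≠ 0 := fun k hk =>
      invProd_ne_zero hη fun j => hv _ k hk
    have hx : invProd η w x ≠ 0 := by simpa using hne 0 (by omega)
    have hx1 : invProd η w (x + η) ≠ 0 := by simpa using hne 1 (by omega)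
    have hxN : invProd η w (x + N * η) ≠ 0 := hne N (by omega)
    have hy : invProd η w (x + N * η + η) ≠ 0 := by
      simpa [add_mul, add_assoc] using hne (N + 1) le_rfl
    have hq : x - v (Fin.last (N + 1)) ≠ 0 :=
      sub_ne_zero.2 (by simpa using (hv (Fin.last (N + 1)) 0 (by omega)).symm)
    have hqy : x + N * η + η - v (Fin.last (N + 1)) ≠ 0 :=
      sub_ne_zero.2 (by
        simpa [add_mul, add_assoc] using (hv (Fin.last (N + 1)) (N + 1) le_rfl).symm)
    have hfun : (fun k : ℕ => invProd η v (x + k * η)) =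
        fun k : ℕ => ((x - v (Fin.last (N + 1))) / η + k) * invProd η w (x + k * η) := by
      funext k
      rw [invProd_succ]
      field_simp
      ring
    have hshift : (fun k : ℕ => invProd η w (x + η + k * η)) =
        fun k : ℕ => invProd η w (x + ((k + 1 : ℕ) : ℂ) * η) := by
      funext k
      congr 1
      push_cast
      ring
    have hpf : ∏ k : Fin (N + 1), ff η x (v k.castSucc) = invProd η w (x + η) / invProd η w x :=
      prod_ff_left hη w x
    have hpf' : ∏ k : Fin (N + 1), ff η (v k.castSucc) (x + N * η + η) =
        invProd η w (x + N * η) / invProd η w (x + N * η + η) :=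
      prod_ff_right hη w (x + N * η)
    have hend : x + ((N + 1 : ℕ) : ℂ) * η = x + N * η + η := by push_cast; ring
    have hend' : x + η + (N : ℂ) * η = x + N * η + η := by ring
    rw [hsplit, hpf, hpf', ih x w fun j k hk => hv _ k (by omega),
      ih (x + η) w fun j k hk => by
        have := hv j.castSucc (k + 1) (by omega)
        rwa [show x + ((k + 1 : ℕ) : ℂ) * η = x + η + k * η by push_cast; ring] at this,
      hfun, altBinomSum_succ_mul_linear _ _ _ (fun k : ℕ => invProd η w (x + k * η)),
      hshift, hend, hend', invProd_succ η v, invProd_succ η v, ← hw, Nat.factorial_succ (N + 1)]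
    have hvx : v (Fin.last (N + 1)) - x = -(x - v (Fin.last (N + 1))) := by ring
    have hvy : v (Fin.last (N + 1)) - (x + N * η + η) =
      -(x + N * η + η - v (Fin.last (N + 1))) := by ring
    have hqN : (x - v (Fin.last (N + 1))) / η + (N + 1) =
        (x + N * η + η - v (Fin.last (N + 1))) / η := by
      field_simp
      ring
    rw [gg, gg, hvx, hvy, hqN]
    generalize x + N * η + η - v (Fin.last (N + 1)) = b at *
    generalize x - v (Fin.last (N + 1)) = a at *
    generalize invProd η w (x + N * η + η) = py at *
    generalize invProd η w (x + N * η) = pN at *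
    push_cast
    field_simp
    ring

/-- the recursively defined functions `F_n` evaluate, on an arithmetic
progression `u_k = u_1 + (k−1)η`, to the explicit binomial sum. -/
theorem stmt0 (η β : ℂ) (hη : η ≠ 0)
    (F : ∀ n : ℕ, (Fin n → ℂ) → (Fin n → ℂ) → ℂ)
    (hF1 : ∀ v u : Fin 1 → ℂ, F 1 v u = gg η (u 0) (v 0) * (Complex.exp β - 1))
    (hFrec : ∀ (n : ℕ) (v u : Fin (n + 2) → ℂ),
      F (n + 2) v u = ∑ j : Fin (n + 2),
        gg η (v (Fin.last (n + 1))) (u j) *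
          ((∏ k : Fin (n + 1), ff η (u j) (u (j.succAbove k))) *
              (∏ k : Fin (n + 1), ff η (v k.castSucc) (u j)) -
            Complex.exp β * (∏ k : Fin (n + 1), ff η (u (j.succAbove k)) (u j)) *
              (∏ k : Fin (n + 1), ff η (u j) (v k.castSucc))) *
          F (n + 1) (v ∘ Fin.castSucc) (u ∘ j.succAbove))
    (N : ℕ) (u v : Fin (N + 1) → ℂ)
    (hu : ∀ k : Fin (N + 1), u k = u 0 + ((k : ℕ) : ℂ) * η)
    (hv : Function.Injective v)
    (hvu : ∀ j k, v j ≠ u k) :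
    F (N + 1) v u =
      (Complex.exp β - 1) * (Nat.factorial (N + 1) : ℂ) *
        (∏ j, gg η (u 0) (v j)) * (∏ j, gg η (u (Fin.last N)) (v j)) *
        ∑ k : Fin (N + 1), (N.choose k : ℂ) * Complex.exp β ^ (k : ℕ) *
          (-1) ^ (N - (k : ℕ)) / ∏ j, gg η (u k) (v j) := by
  have hu' : u = arith η (u 0) (N + 1) := funext hu
  have hmain := recursion_on_arith η β hη F hF1 hFrec N (u 0) v fun j k hk => by
    simpa [hu ⟨k, by omega⟩] using hvu j ⟨k, by omega⟩
  rw [← hu'] at hmain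
  rw [hmain, altBinomSum, ← Fin.sum_univ_eq_sum_range (fun k => (N.choose k : ℂ) *
    Complex.exp β ^ k * (-1) ^ (N + k) * invProd η v (u 0 + k * η)) (N + 1)]
  have hsum : ∀ k : Fin (N + 1), (N.choose k : ℂ) * Complex.exp β ^ (k : ℕ) *
      (-1) ^ (N - (k : ℕ)) / ∏ j, gg η (u k) (v j) =
      (N.choose k : ℂ) * Complex.exp β ^ (k : ℕ) * (-1) ^ (N + (k : ℕ)) *
        invProd η v (u 0 + (k : ℕ) * η) := by
    intro k
    have hsign : (-1 : ℂ) ^ (N + (k : ℕ)) = (-1) ^ (N - (k : ℕ)) := by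
      have hk : N + (k : ℕ) = (N - k) + 2 * k := by have := k.2; omega
      rw [hk, pow_add, pow_mul]
      simp
    rw [prod_gg_eq_inv, div_inv_eq_mul, hsign, ← hu k]
  rw [sum_congr rfl fun k _ => hsum k, prod_gg_eq_inv, prod_gg_eq_inv, hu (Fin.last N),
    Fin.val_last, div_eq_mul_inv, mul_inv]
  ring
end
end

section
/- Let η ≠ 0 and β be complex numbers. Define functions B_n, where B_n takes an (n−1)-tuple v̄ and an n-tuple ū of complex numbers, recursively by B_1((),(u)|β) = 1 and, for n ≥ 2, B_n(v̄,ū|β) = Σ_{j=1}^{n} g(u_j,v_{n−1})·[ e^β f(ū_j,u_j) f(u_j,v̄_{n−1}) − f(u_j,ū_j) f(v̄_{n−1},u_j) ]·B_{n−1}(v̄_{n−1},ū_j|β), where ū_j denotes ū with u_j removed and v̄_{n−1} denotes v̄ with v_{n−1} removed. Then for any n ≥ 1, if u_k = u_1 + (k−1)η for k = 1,…,n and v_1,…,v_{n−1} are pairwise distinct complex numbers, each distinct from every u_k, one has B_n(v̄,ū|β) = n! · g(u_1,v̄) g(u_n,v̄) · Σ_{k=0}^{n−1} binom(n−1,k)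 e^{kβ} (−1)^{n−1−k} / g(u_{k+1},v̄), where each product over v̄ runs over the n−1 entries v_1,…,v_{n−1}. -/
open Finset

noncomputable section

theorem prod_ff_self_left (η a : ℂ) (hη : η ≠ 0) (n : ℕ) (j : Fin (n + 2)) :
    ∏ k : Fin (n + 1), ff η (a + ((j.succAbove k : ℕ) : ℂ) * η) (a + ((j : ℕ) : ℂ) * η) =
      if j = 0 then (n : ℂ) + 2 else 0 := by
  split_ifs with hj
  · subst hj
    have hterm : ∀ k : ℕ, ff η (a + ((k + 1 : ℕ) : ℂ) * η) (a + ((0 : ℕ) : ℂ) * η) =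
        ((k : ℂ) + 2) / (k + 1) := by
      intro k
      have : (k : ℂ) + 1 ≠ 0 := Nat.cast_add_one_ne_zero k
      unfold ff
      push_cast
      rw [show a + ((k : ℂ) + 1) * η - (a + 0 * η) = (k + 1) * η by ring]
      field_simp
      ring
    simp only [Fin.succAbove_zero, Fin.val_succ, Fin.val_zero, hterm]
    rw [Fin.prod_univ_eq_prod_range (fun k : ℕ => ((k : ℂ) + 2) / (k + 1))]
    induction n with
    | zero => simp
    | succ n ih =>
      have : (n : ℂ) + 1 + 1 ≠ 0 := by
        simpa using Nat.cast_add_one_ne_zero (R := ℂ) (n + 1)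
      rw [prod_range_succ, ih]
      push_cast
      field_simp
      ring
  · obtain ⟨i, rfl⟩ := Fin.exists_succ_eq.mpr hj
    refine prod_eq_zero (mem_univ i) ?_
    rw [Fin.succAbove_of_castSucc_lt _ _ Fin.castSucc_lt_succ]
    simp only [ff, Fin.val_succ, Fin.val_castSucc]
    push_cast
    rw [div_eq_zero_iff]
    left
    ring

theorem prod_ff_self_right (η a : ℂ) (hη : η ≠ 0) (n : ℕ) (j : Fin (n + 2)) :
    ∏ k : Fin (n + 1), ff η (a + ((j : ℕ) : ℂ) * η) (a + ((j.succAbove k : ℕ) : ℂ) * η) =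
      if j = Fin.last (n + 1) then (n : ℂ) + 2 else 0 := by
  split_ifs with hj
  · subst hj
    simp only [Fin.succAbove_last, Fin.val_castSucc, Fin.val_last]
    induction n with
    | zero => simp [ff]; field_simp; norm_num
    | succ n ih =>
      have h1 : (n : ℂ) + 2 ≠ 0 := by
        simpa [add_assoc, one_add_one_eq_two] using Nat.cast_add_one_ne_zero (R := ℂ) (n + 1)
      have hshift : ∀ k : Fin (n + 1), ff η (a + ((n + 1 + 1 : ℕ) : ℂ) * η)
          (a + ((k.succ : ℕ) : ℂ) * η) =
          ff η (a + ((n + 1 : ℕ) : ℂ) * η) (a + ((k : ℕ) : ℂ) * η) := by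
        intro k
        simp only [ff, Fin.val_succ]
        push_cast
        congr 1 <;> ring
      rw [Fin.prod_univ_succ]
      simp only [hshift]
      rw [ih]
      simp only [ff, Fin.val_zero]
      push_cast
      rw [show a + ((n : ℂ) + 1 + 1) * η - (a + 0 * η) = (n + 2) * η by ring]
      field_simp
      ring
  · obtain ⟨i, rfl⟩ := Fin.exists_castSucc_eq.mpr hj
    refine prod_eq_zero (mem_univ i) ?_
    rw [Fin.succAbove_of_le_castSucc _ _ le_rfl]
    simp only [ff, Fin.val_succ, Fin.val_castSucc]
    push_cast
    rw [div_eq_zero_iff]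
    left
    ring

theorem ff_eq_gg_div (η u v : ℂ) (hη : η ≠ 0) :
    ff η u v = gg η u v / gg η (u + η) v := by
  unfold ff gg
  field_simp
  ring

theorem ff_eq_gg_div_of_add (η u v : ℂ) (hη : η ≠ 0) (h : u + η - v ≠ 0) :
    ff η v (u + η) = gg η (u + η) v / gg η u v := by
  have hneg : v - (u + η) ≠ 0 := fun h0 => h (by linear_combination -h0)
  unfold ff gg
  field_simp
  ring

theorem gg_pascal (η a w : ℂ) (hη : η ≠ 0) (n k : ℕ) (h0 : a - w ≠ 0)
    (hn : a + (n + 1) * η - w ≠ 0) :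
    gg η a w * (n.choose k : ℂ) + gg η (a + (n + 1) * η) w * (n.choose (k + 1) : ℂ) =
      gg η a w * gg η (a + (n + 1) * η) w * ((n + 1).choose (k + 1) : ℂ) /
        gg η (a + (k + 1) * η) w := by
  have hc : ((n : ℂ) + 1) * n.choose k = (n.choose k + n.choose (k + 1)) * (k + 1) := by
    have := Nat.add_one_mul_choose_eq n k
    rw [Nat.choose_succ_succ] at this
    exact_mod_cast this
  rw [Nat.choose_succ_succ]
  push_cast
  unfold gg
  rw [div_div_eq_mul_div]
  generalize hd : a + ((n : ℂ) + 1) * η - w = d at hn ⊢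
  field_simp
  linear_combination η * hc - n.choose k * hd

theorem sum_gg_pascal (η a w E : ℂ) (hη : η ≠ 0) (n : ℕ) (G : ℕ → ℂ) (h0 : a - w ≠ 0)
    (hn : a + (n + 1) * η - w ≠ 0) :
    gg η a w * (E * ∑ k ∈ range (n + 1), (n.choose k : ℂ) * E ^ k * (-1) ^ (n - k) / G (k + 1)) -
      gg η (a + (n + 1) * η) w *
        ∑ k ∈ range (n + 1), (n.choose k : ℂ) * E ^ k * (-1) ^ (n - k) / G k =
    gg η a w * gg η (a + (n + 1) * η) w *
      ∑ k ∈ range (n + 2), ((n + 1).choose k : ℂ) * E ^ k * (-1) ^ (n + 1 - k) /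
        (G k * gg η (a + k * η) w) := by
  have hsecond : ∑ k ∈ range (n + 1), (n.choose k : ℂ) * E ^ k * (-1) ^ (n - k) / G k =
      -∑ k ∈ range (n + 2), (n.choose k : ℂ) * E ^ k * (-1) ^ (n + 1 - k) / G k := by
    rw [sum_range_succ _ (n + 1), Nat.choose_succ_self, Nat.cast_zero, zero_mul, zero_mul,
      zero_div, add_zero, ← sum_neg_distrib]
    refine sum_congr rfl fun k hk => ?_
    rw [Nat.sub_add_comm (Nat.lt_succ_iff.mp (mem_range.mp hk)), pow_succ]
    ring
  have hg : gg η a w ≠ 0 := div_ne_zero hη h0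
  rw [hsecond, sum_range_succ' _ (n + 1), sum_range_succ' _ (n + 1)]
  simp only [mul_neg, sub_neg_eq_add, mul_add, ← add_assoc, mul_sum, ← sum_add_distrib]
  congr 1
  · refine sum_congr rfl fun k _ => ?_
    have := gg_pascal η a w hη n k h0 hn
    push_cast
    linear_combination (E ^ (k + 1) * (-1) ^ (n - k) / G (k + 1)) * this
  · simp only [Nat.choose_zero_right, Nat.cast_zero, zero_mul, add_zero]
    rw [← div_div]
    field_simp

/-- The closed form on the arithmetic progression `a, a + η, …, a + n η`. -/
theorem recursion_eval_arith_progression (η E : ℂ) (hη : η ≠ 0)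
    (B : ∀ m : ℕ, (Fin m → ℂ) → (Fin (m + 1) → ℂ) → ℂ)
    (hB1 : ∀ (v : Fin 0 → ℂ) (u : Fin 1 → ℂ), B 0 v u = 1)
    (hBrec : ∀ (n : ℕ) (v : Fin (n + 1) → ℂ) (u : Fin (n + 2) → ℂ),
      B (n + 1) v u = ∑ j : Fin (n + 2),
        gg η (u j) (v (Fin.last n)) *
          (E * (∏ k : Fin (n + 1), ff η (u (j.succAbove k)) (u j)) *
              (∏ k : Fin n, ff η (u j) (v k.castSucc)) -
            (∏ k : Fin (n + 1), ff η (u j) (u (j.succAbove k))) *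
              (∏ k : Fin n, ff η (v k.castSucc) (u j))) *
          B n (v ∘ Fin.castSucc) (u ∘ j.succAbove))
    (n : ℕ) (a : ℂ) (v : Fin n → ℂ) (hv : ∀ j, ∀ k ≤ n, a + (k : ℂ) * η - v j ≠ 0) :
    B n v (fun k => a + ((k : ℕ) : ℂ) * η) =
      ((n + 1).factorial : ℂ) * (∏ j, gg η a (v j)) * (∏ j, gg η (a + n * η) (v j)) *
        ∑ k ∈ range (n + 1), (n.choose k : ℂ) * E ^ k * (-1) ^ (n - k) /
          ∏ j, gg η (a + k * η) (v j) := by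
  induction n generalizing a with
  | zero => simp [hB1]
  | succ n ih =>
    have hgne : ∀ k ≤ n + 1, ∏ j : Fin n, gg η (a + (k : ℂ) * η) (v j.castSucc) ≠ 0 :=
      fun k hk => prod_ne_zero_iff.mpr fun j _ => div_ne_zero hη (hv _ k hk)
    have hfirst : ∏ k : Fin n, ff η a (v k.castSucc) =
        (∏ k : Fin n, gg η a (v k.castSucc)) / ∏ k : Fin n, gg η (a + η) (v k.castSucc) := by
      rw [← prod_div_distrib]
      exact prod_congr rfl fun k _ => ff_eq_gg_div _ _ _ hη
    have hlast : ∏ k : Fin n, ff η (v k.castSucc) (a + (n + 1) * η) =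
        (∏ k : Fin n, gg η (a + (n + 1) * η) (v k.castSucc)) /
          ∏ k : Fin n, gg η (a + n * η) (v k.castSucc) := by
      rw [← prod_div_distrib, show a + ((n : ℂ) + 1) * η = a + n * η + η by ring]
      refine prod_congr rfl fun k _ => ff_eq_gg_div_of_add _ _ _ hη ?_
      have := hv k.castSucc (n + 1) le_rfl
      push_cast at this
      rwa [show a + (n : ℂ) * η + η = a + (n + 1) * η by ring]
    have hup := ih (a + η) (v ∘ Fin.castSucc) (by
      intro j k hk
      have := hv j.castSucc (k + 1) (by omega)
      push_cast at this
      rwa [Function.comp, show a + η + (k : ℂ) * η = a + (k + 1) * η by ring])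
    have hdown := ih a (v ∘ Fin.castSucc) fun j k hk => hv j.castSucc k (by omega)
    have hupTail : ((fun k : Fin (n + 2) => a + ((k : ℕ) : ℂ) * η) ∘ (0 : Fin (n + 2)).succAbove) =
        fun k : Fin (n + 1) => a + η + ((k : ℕ) : ℂ) * η := by
      funext k
      simp
      ring
    have hdownInit : ((fun k : Fin (n + 2) => a + ((k : ℕ) : ℂ) * η) ∘
        (Fin.last (n + 1)).succAbove) = fun k : Fin (n + 1) => a + ((k : ℕ) : ℂ) * η := by
      funext k
      simp
    have hpascal := sum_gg_pascal η a (v (Fin.last n)) E hη n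
      (fun k => ∏ j : Fin n, gg η (a + (k : ℂ) * η) (v j.castSucc))
      (by simpa using hv (Fin.last n) 0 (by omega))
      (by simpa using hv (Fin.last n) (n + 1) le_rfl)
    have hone := hgne 1 (by omega)
    have hn := hgne n (by omega)
    rw [hBrec]
    simp only [prod_ff_self_left η a hη, prod_ff_self_right η a hη, mul_sub, sub_mul,
      sum_sub_distrib, mul_ite, ite_mul, mul_zero, zero_mul, sum_ite_eq', mem_univ, if_true]
    rw [hupTail, hdownInit, hup, hdown]
    simp only [Fin.val_zero, Fin.val_last, Nat.cast_zero, Nat.cast_one, one_mul, zero_mul, add_zero,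
      Nat.cast_add, Function.comp, Fin.prod_univ_castSucc] at hpascal hone ⊢
    rw [hfirst, hlast, Nat.factorial_succ (n + 1)]
    have hshift : ∀ k : ℕ, a + η + (k : ℂ) * η = a + (k + 1) * η := fun k => by ring
    simp only [hshift]
    push_cast
    generalize (∑ k ∈ range (n + 1), _ : ℂ) = S₁ at hpascal ⊢
    generalize (∑ k ∈ range (n + 1), _ : ℂ) = S₂ at hpascal ⊢
    generalize (∑ k ∈ range (n + 2), _ : ℂ) = S₃ at hpascal ⊢
    generalize (∏ j : Fin n, gg η (a + η) (v j.castSucc)) = P₁ at hone ⊢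
    generalize (∏ j : Fin n, gg η (a + n * η) (v j.castSucc)) = Pₙ at hn ⊢
    field_simp
    linear_combination ((n : ℂ) + 2) * (n + 1).factorial * (∏ j : Fin n, gg η a (v j.castSucc)) *
      (∏ j : Fin n, gg η (a + (n + 1) * η) (v j.castSucc)) * hpascal

/-- the recursively defined functions `B_n` (here `B m` corresponds to
`B_{m+1}`, acting on an `m`-tuple `v̄` and an `(m+1)`-tuple `ū`) evaluate, on an arithmetic
progression `u_k = u_1 + (k−1)η`, to the explicit binomial sum. -/
theorem stmt1 (η β : ℂ) (hη : η ≠ 0)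
    (B : ∀ m : ℕ, (Fin m → ℂ) → (Fin (m + 1) → ℂ) → ℂ)
    (hB1 : ∀ (v : Fin 0 → ℂ) (u : Fin 1 → ℂ), B 0 v u = 1)
    (hBrec : ∀ (n : ℕ) (v : Fin (n + 1) → ℂ) (u : Fin (n + 2) → ℂ),
      B (n + 1) v u = ∑ j : Fin (n + 2),
        gg η (u j) (v (Fin.last n)) *
          (Complex.exp β * (∏ k : Fin (n + 1), ff η (u (j.succAbove k)) (u j)) *
              (∏ k : Fin n, ff η (u j) (v k.castSucc)) -
            (∏ k : Fin (n + 1), ff η (u j) (u (j.succAbove k))) *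
              (∏ k : Fin n, ff η (v k.castSucc) (u j))) *
          B n (v ∘ Fin.castSucc) (u ∘ j.succAbove))
    (N : ℕ) (u : Fin (N + 1) → ℂ) (v : Fin N → ℂ)
    (hu : ∀ k : Fin (N + 1), u k = u 0 + ((k : ℕ) : ℂ) * η)
    (hv : Function.Injective v)
    (hvu : ∀ j k, v j ≠ u k) :
    B N v u =
      (Nat.factorial (N + 1) : ℂ) *
        (∏ j, gg η (u 0) (v j)) * (∏ j, gg η (u (Fin.last N)) (v j)) *
        ∑ k : Fin (N + 1), (N.choose k : ℂ) * Complex.exp β ^ (k : ℕ) *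
          (-1) ^ (N - (k : ℕ)) / ∏ j, gg η (u k) (v j) := by
  have hfun : u = fun k : Fin (N + 1) => u 0 + ((k : ℕ) : ℂ) * η := funext hu
  have heval := recursion_eval_arith_progression η (Complex.exp β) hη B hB1 hBrec N (u 0) v
    fun j k hk h => hvu j ⟨k, Nat.lt_succ_of_le hk⟩ (by
      rw [hu ⟨k, _⟩]
      exact (sub_eq_zero.mp h).symm)
  rw [← hfun] at heval
  rw [heval, hu (Fin.last N), Fin.val_last,
    ← Fin.sum_univ_eq_sum_range (fun k : ℕ => (N.choose k : ℂ) * Complex.exp β ^ k *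
      (-1) ^ (N - k) / ∏ j, gg η (u 0 + k * η) (v j))]
  simp only [← hu]
end
end

section
/- Let η ≠ 0 and let ȳ, z̄, ξ̄ be tuples of complex numbers with #ȳ = m₁, #z̄ = m₂, #ξ̄ = m₁ + m₂. Assume: the entries of ξ̄ are pairwise distinct, the entries of ȳ are pairwise distinct, the entries of z̄ are pairwise distinct, y_a − η ≠ z_b for all a, b, and every ξ_a is distinct from every y_b, y_b − η, z_b, and z_b + η. Then Σ_{ξ̄ ↦ {ξ̄₁,ξ̄₂}} K_{m₁}(ξ̄₁|ȳ) K_{m₂}(z̄|ξ̄₂) f(ξ̄₂,ξ̄₁) = (−1)^{m₁} f(ξ̄,ȳ) K_{m₁+m₂}((ȳ−η)∪z̄ | ξ̄), where the sum is over all partitions of the entries of ξ̄ into two disjoint subsets ξ̄₁ and ξ̄₂ with #ξ̄₁ = m₁ and #ξ̄₂ = m₂, ȳ−η denotes the tuple (y_1−η, …, y_{m₁}−η), and (ȳ−η)∪z̄ denotes the concatenated tuple of length m₁+m₂. -/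
open Finset

noncomputable section

/-- `h(u,v) = (u−v+η)/η` -/
def hh (η u v : ℂ) : ℂ := (u - v + η) / η

/-- `t(u,v) = η²/((u−v)(u−v+η))` -/
def tt (η u v : ℂ) : ℂ := η ^ 2 / ((u - v) * (u - v + η))

/-- `Δ(w̄) = Π_{j<k} g(w_k,w_j)` -/
def Delta (η : ℂ) {n : ℕ} (w : Fin n → ℂ) : ℂ :=
  ∏ j : Fin n, ∏ k ∈ Finset.univ.filter (fun k => j < k), gg η (w k) (w j)

/-- `Δ'(w̄) = Π_{j<k} g(w_j,w_k)` -/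
def Delta' (η : ℂ) {n : ℕ} (w : Fin n → ℂ) : ℂ :=
  ∏ j : Fin n, ∏ k ∈ Finset.univ.filter (fun k => j < k), gg η (w j) (w k)

/-- The highest coefficient `K_N(v̄|ū)`. -/
def Kc (η : ℂ) (N : ℕ) (v u : Fin N → ℂ) : ℂ :=
  Delta' η v * Delta η u * (∏ j, ∏ k, hh η (v j) (u k)) *
    Matrix.det (Matrix.of fun j k : Fin N => tt η (v j) (u k))

/-- The `m`-tuple of values of `w` on the finset `S`, listed in increasing index order
(meaningful when `S.card = m`). -/
def subT {n : ℕ} (w : Fin n → ℂ) (S : Finset (Fin n)) (m : ℕ) : Fin m → ℂ :=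
  fun i => ((S.sort (· ≤ ·)).map w).getD i 0

/-- The alternating sum over subsets `B ⊆ S` of `∏_{b ∈ B} φ b` weighted by the pair products
`c a b` with `a ∈ S \ B`, `b ∈ B`. -/
def altSum {ι : Type*} [DecidableEq ι] (φ : ι → ℂ) (c : ι → ι → ℂ) (S : Finset ι) : ℂ :=
  ∑ B ∈ S.powerset, (-1) ^ (S \ B).card * (∏ b ∈ B, φ b) * ∏ a ∈ S \ B, ∏ b ∈ B, c a b

/-- The matrix of the difference operator `p ↦ φ(x) p(x - η) - p(x)` acting on monomials,
evaluated at the points `v j`. -/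
def shiftMatrix (η : ℂ) {n : ℕ} (φ v : Fin n → ℂ) : Matrix (Fin n) (Fin n) ℂ :=
  Matrix.of fun j k => φ j * (v j - η) ^ (k : ℕ) - v j ^ (k : ℕ)

theorem altSum_map {ι κ : Type*} [DecidableEq ι] [DecidableEq κ] (e : κ ↪ ι)
    (φ : ι → ℂ) (c : ι → ι → ℂ) (S : Finset κ) :
    altSum φ c (S.map e) = altSum (fun k => φ (e k)) (fun a b => c (e a) (e b)) S := by
  unfold altSum
  symm
  refine Finset.sum_bij (fun B _ => B.map e) ?_ ?_ ?_ ?_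
  · intro B hB
    simpa using hB
  · intro B _ B' _ h
    exact Finset.map_injective e h
  · intro B hB
    obtain ⟨u, hu, rfl⟩ := Finset.subset_map_iff.1 (Finset.mem_powerset.1 hB)
    exact ⟨u, Finset.mem_powerset.2 hu, rfl⟩
  · intro B _
    simp [← Finset.map_sdiff]

theorem det_vandermonde_piecewise_sub (η : ℂ) {n : ℕ} (v : Fin n → ℂ) (hv : Function.Injective v)
    (s : Finset (Fin n)) :
    (Matrix.vandermonde (s.piecewise (fun j => v j - η) v)).det =
      (Matrix.vandermonde v).det * ∏ a ∈ sᶜ, ∏ b ∈ s, ff η (v a) (v b) := by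
  set q : Fin n → Fin n → ℂ := fun b a => if a ∉ s ∧ b ∈ s then ff η (v a) (v b) else 1 with hq
  have hpair : ∏ i, ∏ j ∈ Ioi i, q j i * q i j = ∏ a ∈ sᶜ, ∏ b ∈ s, ff η (v a) (v b) := by
    rw [Finset.prod_prod_Ioi_mul_eq_prod_prod_off_diag, ← Finset.prod_subset (subset_univ sᶜ)]
    · refine Finset.prod_congr rfl fun a ha => ?_
      rw [← Finset.prod_subset (s₁ := s)]
      · refine Finset.prod_congr rfl fun b hb => ?_
        simp [hq, hb, Finset.mem_compl.1 ha]
      · intro b hb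
        simp only [mem_compl, mem_singleton]
        rintro rfl
        exact Finset.mem_compl.1 ha hb
      · intro b _ hb
        simp [hq, hb]
    · intro a _ ha
      refine Finset.prod_eq_one fun b _ => ?_
      simp [hq, not_not.1 (mt Finset.mem_compl.2 ha)]
  rw [Matrix.det_vandermonde, Matrix.det_vandermonde, ← hpair, ← Finset.prod_mul_distrib]
  refine Finset.prod_congr rfl fun i _ => ?_
  rw [← Finset.prod_mul_distrib]
  refine Finset.prod_congr rfl fun j hj => ?_
  have hij : i < j := by simpa using hj
  have h1 : v j - v i ≠ 0 := sub_ne_zero.2 fun h => hij.ne' (hv h)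
  have h2 : v i - v j ≠ 0 := sub_ne_zero.2 fun h => hij.ne (hv h)
  by_cases hi : i ∈ s <;> by_cases hjs : j ∈ s <;> simp [hq, hi, hjs, ff]
  · field_simp
    ring
  · rw [← neg_sub (v j) (v i), mul_div_assoc']
    field_simp
    ring

theorem det_shiftMatrix (η : ℂ) {n : ℕ} (φ v : Fin n → ℂ) (hv : Function.Injective v) :
    (shiftMatrix η φ v).det =
      (Matrix.vandermonde v).det * altSum φ (fun a b => ff η (v a) (v b)) univ := by
  have hrow : shiftMatrix η φ v = (fun j => φ j • fun k : Fin n => (v j - η) ^ (k : ℕ)) +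
      fun j => (-1 : ℂ) • fun k : Fin n => v j ^ (k : ℕ) := by
    ext j k
    simp [shiftMatrix, sub_eq_add_neg]
  change Matrix.detRowAlternating (shiftMatrix η φ v) = _
  rw [hrow, AlternatingMap.map_add_univ, altSum, Finset.mul_sum, Finset.powerset_univ]
  refine Finset.sum_congr rfl fun s _ => ?_
  have hs : s.piecewise (fun j => φ j • fun k : Fin n => (v j - η) ^ (k : ℕ))
      (fun j => (-1 : ℂ) • fun k : Fin n => v j ^ (k : ℕ)) =
      fun j => s.piecewise φ (fun _ => -1) j •
        Matrix.vandermonde (s.piecewise (fun j => v j - η) v) j := by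
    ext j k
    by_cases hj : j ∈ s <;> simp [hj, Matrix.vandermonde_apply]
  have hsmul := AlternatingMap.map_smul_univ (Matrix.detRowAlternating (R := ℂ) (n := Fin n))
    (s.piecewise φ fun _ => -1) (Matrix.vandermonde (s.piecewise (fun j => v j - η) v))
  rw [hs]
  refine hsmul.trans ?_
  change _ • (Matrix.vandermonde _).det = _
  rw [det_vandermonde_piecewise_sub η v hv, Finset.prod_piecewise, ← Finset.compl_eq_univ_sdiff]
  simp only [univ_inter, prod_const, smul_eq_mul]
  ring

/-- Evaluation of a polynomial of small degree as a sum over `Fin n`. -/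
theorem eval_eq_sum_fin {n : ℕ} (p : Polynomial ℂ) (hp : p.natDegree < n) (x : ℂ) :
    p.eval x = ∑ l : Fin n, x ^ (l : ℕ) * p.coeff l := by
  rw [Polynomial.eval_eq_sum_range' hp, ← Fin.sum_univ_eq_sum_range (fun i => p.coeff i * x ^ i)]
  exact Finset.sum_congr rfl fun _ _ => mul_comm _ _

theorem sum_shiftMatrix_mul_coeff (η : ℂ) {n : ℕ} (φ v : Fin n → ℂ) (p : Polynomial ℂ)
    (hp : p.natDegree < n) (j : Fin n) :
    ∑ l, shiftMatrix η φ v j l * p.coeff l = φ j * p.eval (v j - η) - p.eval (v j) := by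
  rw [eval_eq_sum_fin p hp, eval_eq_sum_fin p hp, Finset.mul_sum, ← Finset.sum_sub_distrib]
  refine Finset.sum_congr rfl fun l _ => ?_
  simp only [shiftMatrix, Matrix.of_apply]
  ring

theorem altSum_eq_zero (η : ℂ) {n m : ℕ} (hmn : m < n) (v : Fin n → ℂ) (u : Fin m → ℂ)
    (hv : Function.Injective v) (hvu : ∀ a b, v a ≠ u b) :
    altSum (fun a => ∏ k, ff η (v a) (u k)) (fun a b => ff η (v a) (v b)) univ = 0 := by
  set p : Polynomial ℂ := ∏ k, (Polynomial.X - Polynomial.C (u k - η)) with hp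
  have hmonic : p.Monic := Polynomial.monic_prod_X_sub_C _ _
  have hdeg : p.natDegree = m := by
    rw [hp, Polynomial.natDegree_finsetProd_X_sub_C_eq_card, card_univ, Fintype.card_fin]
  have hdet : (shiftMatrix η (fun a => ∏ k, ff η (v a) (u k)) v).det = 0 := by
    refine Matrix.exists_mulVec_eq_zero_iff.1 ⟨fun l => p.coeff l, ?_, ?_⟩
    · intro h
      have := congrFun h ⟨m, hmn⟩
      have hc : p.coeff m = 1 := by rw [← hdeg]; exact hmonic
      simp [hc] at this
    · ext j
      change ∑ l, shiftMatrix η _ v j l * p.coeff l = 0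
      rw [sum_shiftMatrix_mul_coeff η _ v p (hdeg ▸ hmn), hp, Polynomial.eval_prod,
        Polynomial.eval_prod, ← Finset.prod_mul_distrib, sub_eq_zero]
      refine Finset.prod_congr rfl fun k _ => ?_
      have := sub_ne_zero.2 (hvu j k)
      simp only [ff, Polynomial.eval_sub, Polynomial.eval_X, Polynomial.eval_C]
      rw [show v j - η - (u k - η) = v j - u k by ring, div_mul_cancel₀ _ this]
      ring
  rw [det_shiftMatrix η _ v hv] at hdet
  exact (mul_eq_zero.1 hdet).resolve_left (Matrix.det_vandermonde_ne_zero_iff.2 hv)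

/-- The coefficients of the polynomials `∏_{i ≠ k} (X - w i)`. -/
def nodalCoeff {n : ℕ} (w : Fin n → ℂ) : Matrix (Fin n) (Fin n) ℂ :=
  Matrix.of fun l k => (∏ i ∈ univ.erase k, (Polynomial.X - Polynomial.C (w i))).coeff l

theorem natDegree_nodal_erase {n : ℕ} (w : Fin n → ℂ) (k : Fin n) :
    (∏ i ∈ univ.erase k, (Polynomial.X - Polynomial.C (w i))).natDegree < n := by
  simpa using k.pos

theorem det_nodalCoeff {n : ℕ} (w : Fin n → ℂ) (hw : Function.Injective w) :
    (nodalCoeff w).det = ∏ i, ∏ j ∈ Ioi i, (w i - w j) := by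
  have hmul : Matrix.vandermonde w * nodalCoeff w =
      Matrix.diagonal fun k => ∏ i ∈ univ.erase k, (w k - w i) := by
    ext j k
    rw [Matrix.mul_apply]
    simp only [Matrix.vandermonde_apply, nodalCoeff, Matrix.of_apply]
    rw [← eval_eq_sum_fin _ (natDegree_nodal_erase w k), Polynomial.eval_prod]
    by_cases h : j = k
    · subst h
      simp
    · rw [Matrix.diagonal_apply_ne _ h]
      exact Finset.prod_eq_zero (i := j) (by simp [h]) (by simp)
  have hdet := congrArg Matrix.det hmul
  rw [Matrix.det_mul, Matrix.det_diagonal] at hdet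
  refine mul_left_cancel₀ (Matrix.det_vandermonde_ne_zero_iff.2 hw) (hdet.trans ?_)
  rw [Matrix.det_vandermonde, mul_comm]
  simp_rw [← Finset.prod_mul_distrib]
  rw [Finset.prod_prod_Ioi_mul_eq_prod_prod_off_diag (fun j i => w i - w j)]
  simp [Finset.compl_singleton]

theorem Kc_eq_altSum (η : ℂ) (hη : η ≠ 0) {n : ℕ} (v u : Fin n → ℂ)
    (hv : Function.Injective v) (hu : Function.Injective u)
    (hvu : ∀ a b, v a ≠ u b) (hvu' : ∀ a b, v a ≠ u b - η) :
    Kc η n v u =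
      altSum (fun a => ∏ k, ff η (v a) (u k)) (fun a b => ff η (v a) (v b)) univ := by
  have hw : Function.Injective fun k => u k - η := fun a b h => hu (by simpa using h)
  have hmul : shiftMatrix η (fun a => ∏ k, ff η (v a) (u k)) v * nodalCoeff (fun k => u k - η) =
      Matrix.of fun j k => (η ^ (n - 1) * ∏ i, hh η (v j) (u i)) *
        Matrix.of (fun j k : Fin n => tt η (v j) (u k)) j k := by
    ext j k
    rw [Matrix.mul_apply]
    simp only [nodalCoeff, Matrix.of_apply]
    have hpow : η ^ n = η ^ (n - 1) * η := by
      rw [← pow_succ, Nat.sub_add_cancel k.pos]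
    have hQ : (∏ i, (v j - u i)) ≠ 0 :=
      Finset.prod_ne_zero_iff.2 fun i _ => sub_ne_zero.2 (hvu j i)
    have h1 : v j - u k ≠ 0 := sub_ne_zero.2 (hvu j k)
    have h2 : v j - u k + η ≠ 0 := fun h => hvu' j k (by linear_combination h)
    rw [sum_shiftMatrix_mul_coeff η _ v _ (natDegree_nodal_erase _ k), Polynomial.eval_prod,
      Polynomial.eval_prod]
    simp only [Polynomial.eval_sub, Polynomial.eval_X, Polynomial.eval_C, ff, hh,
      Finset.prod_div_distrib, prod_const, card_univ, Fintype.card_fin, tt]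
    have hs : ∀ i, v j - η - (u i - η) = v j - u i := fun i => by ring
    have ha : ∀ i, v j - (u i - η) = v j - u i + η := fun i => by ring
    simp only [hs, ha]
    rw [← Finset.mul_prod_erase univ (fun i => v j - u i) (mem_univ k),
      ← Finset.mul_prod_erase univ (fun i => v j - u i + η) (mem_univ k), hpow] at *
    have hQ' := right_ne_zero_of_mul hQ
    field_simp
    ring
  have hdet := congrArg Matrix.det hmul
  rw [Matrix.det_mul, Matrix.det_mul_column, det_shiftMatrix η _ v hv, det_nodalCoeff _ hw,
    Finset.prod_mul_distrib] at hdet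
  have hV := Matrix.det_vandermonde_ne_zero_iff.2 hv
  have hU : ∏ i, ∏ j ∈ Ioi i, ((u i - η) - (u j - η)) ≠ 0 :=
    Finset.prod_ne_zero_iff.2 fun i _ => Finset.prod_ne_zero_iff.2 fun j hj =>
      sub_ne_zero.2 fun h => (Finset.mem_Ioi.1 hj).ne (hw h)
  have hE : Delta' η v * Delta η u * (Matrix.vandermonde v).det *
      ∏ i, ∏ j ∈ Ioi i, ((u i - η) - (u j - η)) = ∏ _j : Fin n, η ^ (n - 1) := by
    have hconst : ∏ i : Fin n, ∏ _j ∈ Ioi i, η * η = ∏ _j : Fin n, η ^ (n - 1) := by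
      rw [Finset.prod_prod_Ioi_mul_eq_prod_prod_off_diag (fun _ _ => η)]
      simp [Finset.card_compl]
    rw [← hconst, Matrix.det_vandermonde, Delta, Delta']
    simp only [Finset.filter_lt_eq_Ioi, ← Finset.prod_mul_distrib]
    refine Finset.prod_congr rfl fun i _ => Finset.prod_congr rfl fun j hj => ?_
    have hij := (Finset.mem_Ioi.1 hj).ne
    have h1 : v i - v j ≠ 0 := sub_ne_zero.2 fun h => hij (hv h)
    have h2 : u j - u i ≠ 0 := sub_ne_zero.2 fun h => hij (hu h).symm
    simp only [gg]
    field_simp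
    ring
  rw [Kc]
  refine mul_left_cancel₀ (mul_ne_zero hV hU) ?_
  linear_combination (∏ j, ∏ i, hh η (v j) (u i)) *
    (Matrix.of fun j k : Fin n => tt η (v j) (u k)).det * hE - hdet

theorem tt_neg (η a b : ℂ) : tt η (-a) (-b) = tt η b a := by
  simp only [tt, neg_sub_neg]

theorem ff_neg (η a b : ℂ) : ff η (-a) (-b) = ff η b a := by
  simp only [ff, neg_sub_neg]

theorem Kc_neg (η : ℂ) {n : ℕ} (v u : Fin n → ℂ) :
    Kc η n (fun i => -u i) (fun i => -v i) = Kc η n v u := by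
  have hdet : (Matrix.of fun j k : Fin n => tt η (-u j) (-v k)).det =
      (Matrix.of fun j k : Fin n => tt η (v j) (u k)).det := by
    rw [← Matrix.det_transpose]
    congr 1
    ext j k
    simp [tt_neg]
  rw [Kc, Kc, hdet, Finset.prod_comm]
  simp only [Delta, Delta', gg, hh, neg_sub_neg]
  ring

theorem Kc_eq_altSum_right (η : ℂ) (hη : η ≠ 0) {n : ℕ} (v u : Fin n → ℂ)
    (hv : Function.Injective v) (hu : Function.Injective u)
    (hvu : ∀ a b, u a ≠ v b) (hvu' : ∀ a b, u a ≠ v b + η) :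
    Kc η n v u =
      altSum (fun a => ∏ k, ff η (v k) (u a)) (fun a b => ff η (u b) (u a)) univ := by
  rw [← Kc_neg, Kc_eq_altSum η hη (fun i => -u i) (fun i => -v i)
    (neg_injective.comp hu) (neg_injective.comp hv)]
  · simp only [ff_neg]
  · exact fun a b h => hvu a b (neg_injective h)
  · exact fun a b h => hvu' a b (by linear_combination -h)

theorem altSum_eq_zero_right (η : ℂ) {n m : ℕ} (hmn : m < n) (v : Fin m → ℂ) (u : Fin n → ℂ)
    (hu : Function.Injective u) (hvu : ∀ a b, u a ≠ v b) :
    altSum (fun a => ∏ k, ff η (v k) (u a)) (fun a b => ff η (u b) (u a)) univ = 0 := by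
  have := altSum_eq_zero η hmn (fun i => -u i) (fun i => -v i) (neg_injective.comp hu)
    fun a b h => hvu a b (neg_injective h)
  simpa only [ff_neg] using this

theorem subT_eq {n m : ℕ} (w : Fin n → ℂ) (S : Finset (Fin n)) (h : S.card = m) :
    subT w S m = fun i => w (S.orderEmbOfFin h i) := by
  ext i
  simp [subT, Finset.orderEmbOfFin_apply, h]

theorem altSum_orderEmbOfFin {n m : ℕ} (φ : Fin n → ℂ) (c : Fin n → Fin n → ℂ)
    (S : Finset (Fin n)) (h : S.card = m) :
    altSum φ c S = altSum (fun k => φ (S.orderEmbOfFin h k))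
      (fun a b => c (S.orderEmbOfFin h a) (S.orderEmbOfFin h b)) univ := by
  conv_lhs => rw [← Finset.map_orderEmbOfFin_univ S h]
  exact altSum_map _ φ c univ

/-- Convolution of two alternating sums: if all alternating sums with trivial weight vanish, only
the partitions into two blocks survive. -/
theorem sum_altSum_mul_altSum {ι : Type*} [Fintype ι] [DecidableEq ι] (φ ψ : ι → ℂ)
    (c : ι → ι → ℂ) (hc : ∀ D : Finset ι, D.Nonempty → altSum (fun _ => 1) c D = 0) :
    ∑ S : Finset ι, (-1) ^ S.card * (altSum φ c S * altSum ψ (fun a b => c b a) Sᶜ *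
      ∏ a ∈ Sᶜ, ∏ b ∈ S, c a b) =
    ∑ A : Finset ι, (-1) ^ Aᶜ.card * (∏ a ∈ A, ψ a) * (∏ b ∈ Aᶜ, φ b) *
      ∏ a ∈ A, ∏ b ∈ Aᶜ, c a b := by
  have hterm : ∀ A B D : Finset ι, D = (A ∪ B)ᶜ → Disjoint A B →
      ∑ E ∈ D.powerset, (-1) ^ (B ∪ E).card *
        (((-1) ^ E.card * (∏ b ∈ B, φ b) * ∏ a ∈ E, ∏ b ∈ B, c a b) *
        ((-1) ^ (D \ E).card * (∏ a ∈ A, ψ a) * ∏ a ∈ D \ E, ∏ b ∈ A, c b a) *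
        ∏ a ∈ A ∪ (D \ E), ∏ b ∈ B ∪ E, c a b) =
      if B = Aᶜ then (-1) ^ Aᶜ.card * (∏ a ∈ A, ψ a) * (∏ b ∈ Aᶜ, φ b) *
        ∏ a ∈ A, ∏ b ∈ Aᶜ, c a b else 0 := by
    intro A B D hD hAB
    split_ifs with hB
    · subst hB
      have : D = ∅ := by simp [hD]
      subst this
      simp
      ring
    · have hDne : D.Nonempty := by
        rw [Finset.nonempty_iff_ne_empty]
        rintro rfl
        apply hB
        have hun : A ∪ B = univ := by rw [← compl_eq_empty_iff, ← hD]
        exact (IsCompl.of_eq (disjoint_iff.1 hAB) hun).compl_eq.symm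
      rw [← mul_zero ((-1) ^ B.card * (∏ b ∈ B, φ b) * (∏ a ∈ A, ψ a) *
        (∏ a ∈ A, ∏ b ∈ B, c a b) * (∏ a ∈ A, ∏ b ∈ D, c a b) * ∏ a ∈ D, ∏ b ∈ B, c a b),
        ← hc D hDne, altSum, Finset.mul_sum]
      refine Finset.sum_congr rfl fun E hE => ?_
      have hE := Finset.mem_powerset.1 hE
      have hBD : Disjoint B D := by
        rw [hD, Finset.disjoint_left]; intro x hx; simp [hx]
      have hAD : Disjoint A D := by
        rw [hD, Finset.disjoint_left]; intro x hx; simp [hx]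
      have hBE : Disjoint B E := hBD.mono_right hE
      have hAE : Disjoint A (D \ E) := hAD.mono_right sdiff_subset
      have hsplit : ∀ g : ι → ℂ, ∏ x ∈ D, g x = (∏ x ∈ D \ E, g x) * ∏ x ∈ E, g x :=
        fun g => (Finset.prod_sdiff hE).symm
      have hcomm : ∏ a ∈ D \ E, ∏ b ∈ A, c b a = ∏ a ∈ A, ∏ b ∈ D \ E, c a b :=
        Finset.prod_comm
      rw [Finset.card_union_of_disjoint hBE, Finset.prod_union hAE, hcomm, pow_add]
      simp only [Finset.prod_union hBE, Finset.prod_mul_distrib, hsplit, prod_const_one, mul_one]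
      have hsq : ((-1 : ℂ) ^ E.card) * (-1) ^ E.card = 1 := by
        rw [← mul_pow]; simp
      linear_combination ((-1) ^ B.card * (-1) ^ (D \ E).card * (∏ b ∈ B, φ b) *
        (∏ a ∈ A, ψ a) * (∏ a ∈ E, ∏ b ∈ B, c a b) * (∏ a ∈ A, ∏ b ∈ D \ E, c a b) *
        (∏ a ∈ A, ∏ b ∈ B, c a b) * (∏ a ∈ A, ∏ b ∈ E, c a b) *
        (∏ a ∈ D \ E, ∏ b ∈ B, c a b) * (∏ a ∈ D \ E, ∏ b ∈ E, c a b)) * hsq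
  have hR : ∀ A : Finset ι, (-1) ^ Aᶜ.card * (∏ a ∈ A, ψ a) * (∏ b ∈ Aᶜ, φ b) *
      ∏ a ∈ A, ∏ b ∈ Aᶜ, c a b = ∑ B ∈ Aᶜ.powerset, ∑ E ∈ (A ∪ B)ᶜ.powerset,
        (-1) ^ (B ∪ E).card *
        (((-1) ^ E.card * (∏ b ∈ B, φ b) * ∏ a ∈ E, ∏ b ∈ B, c a b) *
        ((-1) ^ ((A ∪ B)ᶜ \ E).card * (∏ a ∈ A, ψ a) * ∏ a ∈ (A ∪ B)ᶜ \ E, ∏ b ∈ A, c b a) *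
        ∏ a ∈ A ∪ ((A ∪ B)ᶜ \ E), ∏ b ∈ B ∪ E, c a b) := by
    intro A
    rw [Finset.sum_congr rfl fun B hB => hterm A B _ rfl
      (le_compl_iff_disjoint_left.1 (Finset.mem_powerset.1 hB)), Finset.sum_ite_eq']
    simp
  simp_rw [hR, altSum, Finset.sum_mul_sum, Finset.sum_mul, Finset.mul_sum, Finset.sum_sigma']
  refine Finset.sum_bij' (fun x _ => ⟨x.2.2, x.2.1, x.1 \ x.2.1⟩)
    (fun x _ => ⟨x.2.1 ∪ x.2.2, x.2.1, x.1⟩) ?_ ?_ ?_ ?_ ?_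
  · rintro ⟨S, B, A⟩ h
    simp only [mem_sigma, mem_univ, mem_powerset, true_and] at h ⊢
    refine ⟨Finset.subset_compl_comm.1 (h.2.trans (Finset.compl_subset_compl.2 h.1)),
      fun x hx => ?_⟩
    have hA : x ∈ A → x ∉ S := fun hxA => Finset.mem_compl.1 (h.2 hxA)
    simp only [mem_sdiff, mem_compl, mem_union] at hx ⊢
    tauto
  · rintro ⟨A, B, E⟩ h
    simp only [mem_sigma, mem_univ, mem_powerset, true_and] at h ⊢
    refine ⟨Finset.subset_union_left, fun x hx => ?_⟩
    have hB : x ∈ B → x ∉ A := fun hxB => Finset.mem_compl.1 (h.1 hxB)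
    have hE : x ∈ E → x ∉ A ∪ B := fun hxE => Finset.mem_compl.1 (h.2 hxE)
    simp only [mem_compl, mem_union] at hE ⊢
    tauto
  · rintro ⟨S, B, A⟩ h
    simp only [mem_sigma, mem_univ, mem_powerset, true_and] at h ⊢
    rw [Finset.union_sdiff_of_subset h.1]
  · rintro ⟨A, B, E⟩ h
    simp only [mem_sigma, mem_univ, mem_powerset, true_and] at h ⊢
    have : (B ∪ E) \ B = E := by
      ext x
      have hE : x ∈ E → x ∉ A ∪ B := fun hxE => Finset.mem_compl.1 (h.2 hxE)
      simp only [mem_sdiff, mem_union] at hE ⊢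
      tauto
    rw [this]
  · rintro ⟨S, B, A⟩ h
    simp only [mem_sigma, mem_univ, mem_powerset, true_and] at h ⊢
    have h1 : B ∪ S \ B = S := Finset.union_sdiff_of_subset h.1
    have h2 : (A ∪ B)ᶜ \ (S \ B) = Sᶜ \ A := by
      ext x
      have hA : x ∈ A → x ∉ S := fun hxA => Finset.mem_compl.1 (h.2 hxA)
      have hB : x ∈ B → x ∈ S := fun hxB => h.1 hxB
      simp only [mem_sdiff, mem_compl, mem_union]
      tauto
    have h3 : A ∪ Sᶜ \ A = Sᶜ := Finset.union_sdiff_of_subset h.2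
    rw [h1, h2, h3]

/-- summation identity (Lemma 1) for the highest coefficients. -/
theorem stmt2 (η : ℂ) (hη : η ≠ 0) (m₁ m₂ : ℕ)
    (y : Fin m₁ → ℂ) (z : Fin m₂ → ℂ) (ξ : Fin (m₁ + m₂) → ℂ)
    (hξ : Function.Injective ξ) (hy : Function.Injective y) (hz : Function.Injective z)
    (hyz : ∀ a b, y a - η ≠ z b)
    (hξy : ∀ a b, ξ a ≠ y b) (hξy' : ∀ a b, ξ a ≠ y b - η)
    (hξz : ∀ a b, ξ a ≠ z b) (hξz' : ∀ a b, ξ a ≠ z b + η) :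
    ∑ S ∈ Finset.powersetCard m₁ (Finset.univ : Finset (Fin (m₁ + m₂))),
      Kc η m₁ (subT ξ S m₁) y * Kc η m₂ z (subT ξ Sᶜ m₂) *
        ∏ a ∈ Sᶜ, ∏ b ∈ S, ff η (ξ a) (ξ b)
    = (-1) ^ m₁ * (∏ a, ∏ b, ff η (ξ a) (y b)) *
        Kc η (m₁ + m₂) (Fin.append (fun i => y i - η) z) ξ := by
  set φ : Fin (m₁ + m₂) → ℂ := fun a => ∏ k, ff η (ξ a) (y k) with hφ
  set ψ : Fin (m₁ + m₂) → ℂ := fun a => ∏ k, ff η (z k) (ξ a) with hψ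
  set c : Fin (m₁ + m₂) → Fin (m₁ + m₂) → ℂ := fun a b => ff η (ξ a) (ξ b) with hc
  have hinj : ∀ (S : Finset (Fin (m₁ + m₂))) {n : ℕ} (h : S.card = n),
      Function.Injective fun i => ξ (S.orderEmbOfFin h i) :=
    fun S _ h => hξ.comp (S.orderEmbOfFin h).injective
  have hvanish : ∀ D : Finset (Fin (m₁ + m₂)), D.Nonempty → altSum (fun _ => 1) c D = 0 := by
    intro D hD
    rw [altSum_orderEmbOfFin _ _ D rfl]
    simpa using altSum_eq_zero η hD.card_pos _ (Fin.elim0 : Fin 0 → ℂ) (hinj D rfl)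
      fun _ b => b.elim0
  have hsize : ∀ S : Finset (Fin (m₁ + m₂)), S.card + Sᶜ.card = m₁ + m₂ := fun S => by
    simp
  have hleft : ∑ S ∈ Finset.powersetCard m₁ (Finset.univ : Finset (Fin (m₁ + m₂))),
      Kc η m₁ (subT ξ S m₁) y * Kc η m₂ z (subT ξ Sᶜ m₂) * ∏ a ∈ Sᶜ, ∏ b ∈ S, ff η (ξ a) (ξ b) =
      (-1) ^ m₁ * ∑ S : Finset (Fin (m₁ + m₂)), (-1) ^ S.card *
        (altSum φ c S * altSum ψ (fun a b => c b a) Sᶜ * ∏ a ∈ Sᶜ, ∏ b ∈ S, c a b) := by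
    rw [Finset.mul_sum, ← Finset.sum_subset (subset_univ (Finset.powersetCard m₁ univ))]
    · refine Finset.sum_congr rfl fun S hS => ?_
      have hS : S.card = m₁ := (Finset.mem_powersetCard.1 hS).2
      have hS' : Sᶜ.card = m₂ := by have := hsize S; omega
      rw [subT_eq ξ S hS, subT_eq ξ Sᶜ hS', altSum_orderEmbOfFin φ c S hS,
        altSum_orderEmbOfFin ψ _ Sᶜ hS',
        Kc_eq_altSum η hη _ y (hinj S hS) hy (fun _ _ => hξy _ _) (fun _ _ => hξy' _ _),
        Kc_eq_altSum_right η hη z _ hz (hinj Sᶜ hS') (fun _ _ => hξz _ _) (fun _ _ => hξz' _ _),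
        hS, ← mul_assoc ((-1) ^ m₁) ((-1) ^ m₁), ← mul_pow]
      simp [hφ, hψ, hc]
    · intro S _ hS
      have hS : S.card ≠ m₁ := fun h => hS (by simp [Finset.mem_powersetCard, h])
      rcases lt_or_gt_of_ne hS with h | h
      · have hS' : m₂ < Sᶜ.card := by have := hsize S; omega
        have h0 := altSum_eq_zero_right η hS' z _ (hinj Sᶜ rfl) (fun _ _ => hξz _ _)
        rw [altSum_orderEmbOfFin ψ _ Sᶜ rfl, h0]
        simp
      · have h0 := altSum_eq_zero η h _ y (hinj S rfl) (fun _ _ => hξy _ _)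
        rw [altSum_orderEmbOfFin φ c S rfl, h0]
        simp
  have hw : Function.Injective (Fin.append (fun i => y i - η) z) := by
    rw [Fin.append_injective_iff]
    exact ⟨fun a b h => hy (by simpa using h), hz, hyz⟩
  rw [hleft, sum_altSum_mul_altSum φ ψ c hvanish, mul_assoc,
    Kc_eq_altSum_right η hη _ ξ hw hξ, altSum, Finset.powerset_univ, Finset.mul_sum _ _ (∏ a, _)]
  · congr 1
    refine Finset.sum_congr rfl fun A _ => ?_
    have hA : (∏ a, φ a) * ∏ a ∈ A, ∏ k, ff η (y k - η) (ξ a) = ∏ a ∈ Aᶜ, φ a := by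
      rw [← Finset.prod_mul_prod_compl A φ, mul_right_comm, ← Finset.prod_mul_distrib]
      rw [Finset.prod_eq_one fun a _ => ?_, one_mul]
      rw [hφ, ← Finset.prod_mul_distrib]
      refine Finset.prod_eq_one fun k _ => ?_
      have h1 : ξ a - y k ≠ 0 := sub_ne_zero.2 (hξy a k)
      have h2 : ξ a - y k + η ≠ 0 := fun h => hξy' a k (by linear_combination h)
      have h3 : y k - η - ξ a ≠ 0 := fun h => h2 (by linear_combination -h)
      simp only [ff]
      field_simp
      ring
    have happ : ∀ a, ∏ k, ff η (Fin.append (fun i => y i - η) z k) (ξ a) =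
        (∏ k, ff η (y k - η) (ξ a)) * ψ a := fun a => by
      rw [Fin.prod_univ_add]
      simp only [Fin.append_left, Fin.append_right, hψ]
    simp only [happ, Finset.prod_mul_distrib]
    rw [← hA, ← Finset.compl_eq_univ_sdiff, Finset.prod_comm (s := Aᶜ)]
    ring
  · intro a b
    refine Fin.addCases (fun i => ?_) (fun i => ?_) b
    · simpa using hξy' a i
    · simpa using hξz a i
  · intro a b
    refine Fin.addCases (fun i => ?_) (fun i => ?_) b
    · simpa using hξy a i
    · simpa using hξz' a i
end
end

section
/- Let η ≠ 0, let w̄ and ξ̄ be m-tuples of complex numbers, and let C₁, C₂ : ℂ → ℂ be arbitrary functions. Assume: the entries of w̄ are pairwise distinct with w_a − w_b ∉ {η, −η} for a ≠ b, the entries of ξ̄ are pairwise distinct, and w_a − ξ_b ∉ {0, η, −η} for all a, b. Then Σ_{w̄ ↦ {w̄₁,w̄₂}} K_m((w̄₁−η)∪w̄₂ | ξ̄) · f(ξ̄,w̄₁) f(w̄₂,w̄₁) C₁(w̄₁) C₂(w̄₂) = Δ'(ξ̄) Δ(w̄) · det_m[ C₂(w_k) t(w_k,ξ_j) h(w_k,ξ̄)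 + (−1)^m C₁(w_k) t(ξ_j,w_k) h(ξ̄,w_k) ]_{j,k=1}^{m}, where the sum is over all 2^m partitions of the entries of w̄ into disjoint subsets w̄₁ and w̄₂ (of any sizes), w̄₁−η denotes the tuple obtained by subtracting η from each entry of w̄₁, C_i(w̄) denotes Π C_i(w_a) over the entries, and (w̄₁−η)∪w̄₂ is the combined m-tuple. -/
open Finset

noncomputable section


/-- Reversing the order in both products contributes the same sign. -/
lemma Delta'_mul_Delta_comm (η : ℂ) {m : ℕ} (w ξ : Fin m → ℂ) :
    Delta' η w * Delta η ξ = Delta' η ξ * Delta η w := by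
  simp only [Delta', Delta, ← prod_mul_distrib]
  refine prod_congr rfl fun j _ => prod_congr rfl fun k _ => ?_
  rw [gg, gg, gg, gg, ← neg_sub (ξ j) (ξ k), ← neg_sub (w j) (w k), div_neg, div_neg]
  ring

/-- The factors `f(w̄₂,w̄₁)` undo the shift of `w̄₁` inside `Δ'`. -/
lemma Delta'_shift (η : ℂ) {m : ℕ} (w : Fin m → ℂ)
    (hwη : ∀ a b, a ≠ b → w a - w b ≠ η ∧ w a - w b ≠ -η) (S : Finset (Fin m)) :
    Delta' η (fun i => if i ∈ S then w i - η else w i) *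
      (∏ a ∈ Sᶜ, ∏ b ∈ S, ff η (w a) (w b)) = Delta' η w := by
  let G : Fin m → Fin m → ℂ := fun b a => if a ∉ S ∧ b ∈ S then ff η (w a) (w b) else 1
  have hG : (∏ a ∈ Sᶜ, ∏ b ∈ S, ff η (w a) (w b)) =
      ∏ i, ∏ j ∈ univ.filter (fun j => i < j), G j i * G i j := by
    have hoff := prod_prod_Ioi_mul_eq_prod_prod_off_diag G
    have hIoi : ∀ i : Fin m, univ.filter (fun j => i < j) = Ioi i := fun i => by ext; simp
    simp only [hIoi]
    rw [hoff, ← prod_subset (subset_univ Sᶜ)]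
    · refine prod_congr rfl fun a ha => ?_
      have ha' : a ∉ S := mem_compl.mp ha
      have hS : ∏ b ∈ S, ff η (w a) (w b) = ∏ b ∈ S, G b a :=
        prod_congr rfl fun b hb => by simp [G, ha', hb]
      rw [hS]
      apply prod_subset
      · intro b hb
        simp only [mem_compl, mem_singleton]
        rintro rfl
        exact ha' hb
      · intro b _ hb
        simp [G, hb]
    · intro a _ ha
      refine prod_eq_one fun b _ => ?_
      have : a ∈ S := by simpa using ha
      simp [G, this]
  rw [hG]
  simp only [Delta', ← prod_mul_distrib]
  refine prod_congr rfl fun j _ => prod_congr rfl fun k hk => ?_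
  have hne : j ≠ k := (mem_filter.mp hk).2.ne
  obtain ⟨hsub, hadd⟩ := hwη j k hne
  by_cases hj : j ∈ S <;> by_cases hkS : k ∈ S <;> simp only [G, hj, hkS, gg, ff, if_true,
    if_false, not_true, not_false_eq_true, and_true, and_false, one_mul, mul_one]
  · congr 1; ring
  · have hden : w j - w k - η ≠ 0 := sub_ne_zero.mpr hsub
    rw [show w j - η - w k = w j - w k - η by ring,
      show w k - w j + η = -(w j - w k - η) by ring, ← neg_sub (w j) (w k), neg_div_neg_eq,
      div_mul_div_comm, mul_comm η, mul_div_mul_left _ _ hden]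
  · have hden : w j - w k + η ≠ 0 := fun h => hadd (eq_neg_of_add_eq_zero_left h)
    rw [show w j - (w k - η) = w j - w k + η by ring,
      div_mul_div_comm, mul_comm η, mul_div_mul_left _ _ hden]

/-- The shift by `η` exchanges the arguments of `t`. -/
lemma tt_sub_eta (η u v : ℂ) : tt η (u - η) v = tt η v u := by
  simp only [tt]
  congr 1
  ring

lemma prod_hh_sub_eta_mul_ff (η : ℂ) {m : ℕ} (u : ℂ) (ξ : Fin m → ℂ)
    (h : ∀ a, u - ξ a ≠ 0) :
    (∏ a, hh η (u - η) (ξ a)) * ∏ a, ff η (ξ a) u = (-1) ^ m * ∏ a, hh η (ξ a) u := by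
  have hsign : (-1 : ℂ) ^ m = ∏ _a : Fin m, (-1 : ℂ) := by simp
  rw [hsign, ← prod_mul_distrib, ← prod_mul_distrib]
  refine prod_congr rfl fun a _ => ?_
  have hden : ξ a - u ≠ 0 := fun h0 => h a (by rw [← neg_sub, h0, neg_zero])
  simp only [hh, ff]
  rw [show u - η - ξ a + η = -(ξ a - u) by ring]
  field_simp

/-- A determinant whose columns are sums expands over the subsets of columns. -/
lemma det_of_add_eq_sum {m : ℕ} (A B : Fin m → Fin m → ℂ) :
    Matrix.det (Matrix.of fun j k => B k j + A k j) =
      ∑ S : Finset (Fin m), Matrix.det (Matrix.of fun k j => if k ∈ S then A k j else B k j) := by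
  have hsum : (Matrix.of fun j k => B k j + A k j).transpose = A + B := by
    ext k j
    exact add_comm _ _
  rw [← Matrix.det_transpose, hsum]
  refine (Matrix.detRowAlternating.toMultilinearMap.map_add_univ A B).trans
    (sum_congr rfl fun S _ => congrArg Matrix.det ?_)
  ext k j
  simp only [Finset.piecewise, Matrix.of_apply]
  split_ifs <;> rfl

/-- summation identity (Lemma 2) giving a determinant representation. -/
theorem stmt3 (η : ℂ) (hη : η ≠ 0) (m : ℕ) (w ξ : Fin m → ℂ) (C₁ C₂ : ℂ → ℂ)
    (hw : Function.Injective w)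
    (hwη : ∀ a b, a ≠ b → w a - w b ≠ η ∧ w a - w b ≠ -η)
    (hξ : Function.Injective ξ)
    (hwξ : ∀ a b, w a - ξ b ≠ 0 ∧ w a - ξ b ≠ η ∧ w a - ξ b ≠ -η) :
    ∑ S : Finset (Fin m),
      Kc η m (fun i => if i ∈ S then w i - η else w i) ξ *
        (∏ j, ∏ a ∈ S, ff η (ξ j) (w a)) * (∏ a ∈ Sᶜ, ∏ b ∈ S, ff η (w a) (w b)) *
        (∏ a ∈ S, C₁ (w a)) * (∏ a ∈ Sᶜ, C₂ (w a))
    = Delta' η ξ * Delta η w *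
        Matrix.det (Matrix.of fun j k : Fin m =>
          C₂ (w k) * tt η (w k) (ξ j) * (∏ a, hh η (w k) (ξ a)) +
            (-1) ^ m * C₁ (w k) * tt η (ξ j) (w k) * (∏ a, hh η (ξ a) (w k))) := by
  have hdet := det_of_add_eq_sum
    (fun k j => (-1) ^ m * C₁ (w k) * tt η (ξ j) (w k) * (∏ a, hh η (ξ a) (w k)))
    (fun k j => C₂ (w k) * tt η (w k) (ξ j) * (∏ a, hh η (w k) (ξ a)))
  rw [hdet, mul_sum]
  refine sum_congr rfl fun S _ => ?_
  set v : Fin m → ℂ := fun i => if i ∈ S then w i - η else w i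
  let c : Fin m → ℂ := fun k => (∏ a, hh η (v k) (ξ a)) *
    if k ∈ S then C₁ (w k) * ∏ a, ff η (ξ a) (w k) else C₂ (w k)
  have hmat : (Matrix.of fun k j => if k ∈ S then
        (-1) ^ m * C₁ (w k) * tt η (ξ j) (w k) * (∏ a, hh η (ξ a) (w k))
      else C₂ (w k) * tt η (w k) (ξ j) * (∏ a, hh η (w k) (ξ a))) =
      Matrix.of fun k j => c k * (Matrix.of fun j k : Fin m => tt η (v j) (ξ k)) k j := by
    ext k j
    by_cases hk : k ∈ S
    · simp only [Matrix.of_apply, c, v, hk, if_true, tt_sub_eta]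
      linear_combination (-(C₁ (w k) * tt η (ξ j) (w k))) *
        prod_hh_sub_eta_mul_ff η (w k) ξ fun a => (hwξ k a).1
    · simp only [Matrix.of_apply, c, v, hk, if_false]
      ring
  have hc : ∏ k, c k = (∏ j, ∏ k, hh η (v j) (ξ k)) *
      ((∏ a ∈ S, C₁ (w a)) * (∏ j, ∏ a ∈ S, ff η (ξ j) (w a)) * ∏ a ∈ Sᶜ, C₂ (w a)) := by
    simp only [c]
    rw [prod_mul_distrib]
    congr 1
    rw [← prod_mul_prod_compl S, prod_comm (s := univ) (t := S), ← prod_mul_distrib]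
    congr 1
    · exact prod_congr rfl fun a ha => by rw [if_pos ha]
    · exact prod_congr rfl fun a ha => by rw [if_neg (mem_compl.mp ha)]
  rw [hmat, Matrix.det_mul_column, hc, ← Delta'_mul_Delta_comm, ← Delta'_shift η w hwη S, Kc]
  ring
end
end

section
/- Let η ≠ 0, β ∈ ℂ, N ≥ 2, and let v̄ = (v_1,…,v_N), ū = (u_1,…,u_N) be tuples of complex numbers such that: the u_j are pairwise distinct, the v_j are pairwise distinct, u_k ≠ v_j for all j, k, u_a − u_b ∉ {η, −η} for a ≠ b, and u_k − v_j ∉ {η, −η} for all j, k. Define, for any pair of n-tuples satisfying these conditions, Φ_n(v̄,ū|β) = Δ'(v̄) Δ(ū) h(ū,v̄) · det_n[ e^β t(u_k,v_j) + t(v_j,u_k) · h(u_k,ū) h(v̄,u_k) / (h(ū,u_k) h(u_k,v̄)) ]_{j,k=1}^{n}. Then Φ_N(v̄,ū|β) = Σ_{j=1}^{N} g(v_N,u_j) · [ f(u_j,ū_j) f(v̄_N,u_j) − e^β f(ū_j,u_j) f(u_j,v̄_N) ] · Φ_{N−1}(v̄_N, ū_j | β), where ū_j denotes ū with u_j removed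 and v̄_N denotes v̄ with v_N removed. -/
open Finset

noncomputable section


/-- The scalar-product function `Φ_n(v̄,ū|β)` (denoted `𝔽^J_n` in the paper). -/
def Phi (η β : ℂ) (n : ℕ) (v u : Fin n → ℂ) : ℂ :=
  Delta' η v * Delta η u * (∏ a, ∏ b, hh η (u a) (v b)) *
    Matrix.det (Matrix.of fun j k : Fin n =>
      Complex.exp β * tt η (u k) (v j) +
        tt η (v j) (u k) * ((∏ a, hh η (u k) (u a)) * ∏ a, hh η (v a) (u k)) /
          ((∏ a, hh η (u a) (u k)) * ∏ a, hh η (u k) (v a)))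

open Polynomial in
/-- A sum `∑ P_k(z) / (z - u_k)` with `deg P_k ≤ m` that vanishes at `m` points `w_a` is
determined by its residues at the `m + 1` points `u_k`. -/
lemma sum_eval_div_eq_sum_residues {m : ℕ} (u : Fin (m + 1) → ℂ) (w : Fin m → ℂ)
    (hu : Function.Injective u) (hw : Function.Injective w) (huw : ∀ a k, u k ≠ w a)
    (P : Fin (m + 1) → ℂ[X]) (hP : ∀ k, (P k).natDegree ≤ m)
    (hvan : ∀ a, ∑ k, (P k).eval (w a) / (w a - u k) = 0)
    (z : ℂ) (hz : ∀ k, z ≠ u k) :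
    ∑ k, (P k).eval z / (z - u k) =
      ∑ k, (P k).eval (u k) / (z - u k) * ∏ a, (z - w a) / (u k - w a) := by
  have clear : ∀ x : ℂ, (∀ k, x ≠ u k) → ∀ c : Fin (m + 1) → ℂ,
      ∑ k, c k * ∏ l : Fin m, (x - u (k.succAbove l)) =
        (∏ k, (x - u k)) * ∑ k, c k / (x - u k) := by
    intro x hx c
    rw [Finset.mul_sum]
    refine Finset.sum_congr rfl fun k _ => ?_
    rw [Fin.prod_univ_succAbove _ k]
    have := sub_ne_zero.2 (hx k)
    field_simp
  have other : ∀ i k : Fin (m + 1), k ≠ i → ∏ l : Fin m, (u i - u (k.succAbove l)) = 0 := by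
    intro i k hki
    obtain ⟨l, hl⟩ := Fin.exists_succAbove_eq hki.symm
    exact Finset.prod_eq_zero (Finset.mem_univ l) (by rw [hl, sub_self])
  have hlin : ∀ k : Fin (m + 1),
      (∏ l : Fin m, (X - C (u (k.succAbove l)))).natDegree ≤ m := fun k => by
    rw [natDegree_finsetProd_X_sub_C_eq_card]; simp
  have hlinw : (∏ a, (X - C (w a))).natDegree ≤ m := by
    rw [natDegree_finsetProd_X_sub_C_eq_card]; simp
  set Q : ℂ[X] := ∑ k, P k * ∏ l : Fin m, (X - C (u (k.succAbove l))) with hQ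
  set R : ℂ[X] := ∑ k, C ((P k).eval (u k) / ∏ a, (u k - w a)) * (∏ a, (X - C (w a))) *
    ∏ l : Fin m, (X - C (u (k.succAbove l))) with hR
  have evQ : ∀ x, Q.eval x = ∑ k, (P k).eval x * ∏ l : Fin m, (x - u (k.succAbove l)) := by
    intro x; simp [hQ, eval_finsetSum, eval_prod]
  have evR : ∀ x, R.eval x = ∑ k, ((P k).eval (u k) / ∏ a, (u k - w a)) *
      (∏ a, (x - w a)) * ∏ l : Fin m, (x - u (k.succAbove l)) := by
    intro x; simp [hR, eval_finsetSum, eval_prod]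
  have hQR : Q = R := by
    have hinj : Function.Injective (Sum.elim u w) :=
      Function.Injective.sumElim hu hw fun k a => huw a k
    refine eq_of_natDegree_lt_card_of_eval_eq Q R hinj ?_ ?_
    · rintro (i | a)
      · rw [Sum.elim_inl, evQ, evR, Finset.sum_eq_single i, Finset.sum_eq_single i]
        · have : ∏ a, (u i - w a) ≠ 0 :=
            Finset.prod_ne_zero_iff.2 fun a _ => sub_ne_zero.2 (huw a i)
          field_simp
        all_goals simp +contextual [other]
      · rw [Sum.elim_inr, evQ, evR, clear _ fun k => (huw a k).symm, hvan, mul_zero]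
        refine (Finset.sum_eq_zero fun k _ => ?_).symm
        have h0 : ∏ b, (w a - w b) = 0 := Finset.prod_eq_zero (Finset.mem_univ a) (sub_self (w a))
        rw [h0, mul_zero, zero_mul]
    · have hQd : Q.natDegree ≤ m + m :=
        natDegree_sum_le_of_forall_le _ _ fun k _ => natDegree_mul_le_of_le (hP k) (hlin k)
      have hRd : R.natDegree ≤ m + m :=
        natDegree_sum_le_of_forall_le _ _ fun k _ =>
          natDegree_mul_le_of_le ((natDegree_C_mul_le _ _).trans hlinw) (hlin k)
      simp only [Fintype.card_sum, Fintype.card_fin]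
      omega
  have key := congrArg (eval z) hQR
  rw [evQ, evR, clear z hz, clear z hz] at key
  have hne : ∏ k, (z - u k) ≠ 0 :=
    Finset.prod_ne_zero_iff.2 fun k _ => sub_ne_zero.2 (hz k)
  rw [mul_left_cancel₀ hne key]
  refine Finset.sum_congr rfl fun k _ => ?_
  rw [Finset.prod_div_distrib]
  ring

lemma hh_self {η : ℂ} (hη : η ≠ 0) (x : ℂ) : hh η x x = 1 := by
  simp [hh, hη]

/-- Extracting the `k`-th variable from `Δ`. -/
lemma Delta_succAbove (η : ℂ) {m : ℕ} (u : Fin (m + 1) → ℂ) (k : Fin (m + 1)) :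
    Delta η u = (-1) ^ (m + (k : ℕ)) * (∏ l, gg η (u k) (u (k.succAbove l))) *
      Delta η (u ∘ k.succAbove) := by
  have hneg : ∀ x y, gg η x y = - gg η y x := fun x y => by
    unfold gg; rw [← neg_sub y x, div_neg]
  have hsign : ∏ l : Fin m, (if k < k.succAbove l then (-1 : ℂ) else 1) =
      (-1) ^ (m + (k : ℕ)) := by
    have h : ∏ i : Fin (m + 1), (if k < i then (-1 : ℂ) else 1) = (-1) ^ (m - (k : ℕ)) := by
      rw [Finset.prod_ite, Finset.prod_const, Finset.prod_const_one, mul_one,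
        Finset.filter_lt_eq_Ioi, Fin.card_Ioi]
      congr 1
    rw [Fin.prod_univ_succAbove _ k, if_neg (lt_irrefl k), one_mul] at h
    rw [h, show m + (k : ℕ) = (m - (k : ℕ)) + 2 * (k : ℕ) by omega, pow_add, pow_mul]
    simp
  unfold Delta
  simp only [Finset.prod_filter, Function.comp_apply]
  have hprod (F : Fin (m + 1) → ℂ) : ∏ i, F i = F k * ∏ l, F (k.succAbove l) :=
    Fin.prod_univ_succAbove F k
  simp only [hprod, Finset.prod_mul_distrib, Fin.succAbove_lt_succAbove_iff, lt_irrefl,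
    if_false, one_mul]
  rw [← hsign, ← mul_assoc]
  congr 1
  rw [← Finset.prod_mul_distrib, ← Finset.prod_mul_distrib]
  refine Finset.prod_congr rfl fun l _ => ?_
  rcases lt_or_gt_of_ne (Fin.succAbove_ne k l) with h | h
  · simp [h, h.not_gt]
  · simp [h, h.not_gt, hneg (u k)]

/-- Extracting the last variable from `Δ'`. -/
lemma Delta'_castSucc (η : ℂ) {m : ℕ} (v : Fin (m + 1) → ℂ) :
    Delta' η v = (∏ a : Fin m, gg η (v a.castSucc) (v (Fin.last m))) *
      Delta' η (v ∘ Fin.castSucc) := by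
  unfold Delta'
  simp only [Finset.prod_filter, Function.comp_apply]
  rw [Fin.prod_univ_castSucc]
  simp only [Fin.prod_univ_castSucc, Finset.prod_mul_distrib, Fin.castSucc_lt_castSucc_iff,
    Fin.castSucc_lt_last, if_true, if_false, (Fin.le_last _).not_gt,
    Finset.prod_const_one, mul_one]
  rw [mul_comm]

/-- The matrix of `Φ` with the denominators of every column cleared. -/
def clearedMatrix (η β : ℂ) {n : ℕ} (v u : Fin n → ℂ) : Matrix (Fin n) (Fin n) ℂ :=
  Matrix.of fun j k =>
    Complex.exp β * tt η (u k) (v j) * ((∏ a, hh η (u a) (u k)) * ∏ a, hh η (u k) (v a)) +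
      tt η (v j) (u k) * ((∏ a, hh η (u k) (u a)) * ∏ a, hh η (v a) (u k))

lemma Phi_eq_det_clearedMatrix (η β : ℂ) {n : ℕ} (v u : Fin n → ℂ)
    (huu : ∀ a b, hh η (u a) (u b) ≠ 0) (huv : ∀ a b, hh η (u a) (v b) ≠ 0) :
    Phi η β n v u = Delta' η v * Delta η u / (∏ k, ∏ a, hh η (u a) (u k)) *
      (clearedMatrix η β v u).det := by
  have h1 : ∀ k, ∏ a, hh η (u a) (u k) ≠ 0 := fun k =>
    Finset.prod_ne_zero_iff.2 fun a _ => huu a k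
  have h2 : ∀ k, ∏ a, hh η (u k) (v a) ≠ 0 := fun k =>
    Finset.prod_ne_zero_iff.2 fun a _ => huv k a
  have h3 : ∏ k, ∏ a, hh η (u a) (u k) ≠ 0 := Finset.prod_ne_zero_iff.2 fun k _ => h1 k
  unfold Phi
  set M : Matrix (Fin n) (Fin n) ℂ := Matrix.of fun j k : Fin n =>
      Complex.exp β * tt η (u k) (v j) +
        tt η (v j) (u k) * ((∏ a, hh η (u k) (u a)) * ∏ a, hh η (v a) (u k)) /
          ((∏ a, hh η (u a) (u k)) * ∏ a, hh η (u k) (v a)) with hM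
  have : clearedMatrix η β v u = Matrix.of fun j k =>
      ((∏ a, hh η (u a) (u k)) * ∏ a, hh η (u k) (v a)) * M j k := by
    ext j k
    have := h1 k
    have := h2 k
    simp only [clearedMatrix, hM, Matrix.of_apply]
    field_simp
  rw [this, Matrix.det_mul_row, Finset.prod_mul_distrib]
  field_simp

/-- The residue coefficient `c_k` of the last row of the cleared matrix. -/
def residueCoeff (η β : ℂ) {m : ℕ} (w : Fin m → ℂ) (u : Fin (m + 1) → ℂ) (k : Fin (m + 1)) : ℂ :=
  (∏ a, hh η (u k) (u a)) * (∏ a, hh η (w a) (u k)) -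
    Complex.exp β * (∏ a, hh η (u a) (u k)) * ∏ a, hh η (u k) (w a)

/-- The rows of the cleared matrix other than the last one, as functions of the last
variable `z`, with the column `k` removed. -/
def minorMatrix (η β : ℂ) {m : ℕ} (w : Fin m → ℂ) (u : Fin (m + 1) → ℂ) (k : Fin (m + 1))
    (z : ℂ) : Matrix (Fin m) (Fin m) ℂ :=
  Matrix.of fun j l =>
    Complex.exp β * tt η (u (k.succAbove l)) (w j) * ((∏ a, hh η (u a) (u (k.succAbove l))) *
        ((∏ a, hh η (u (k.succAbove l)) (w a)) * hh η (u (k.succAbove l)) z)) +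
      tt η (w j) (u (k.succAbove l)) * ((∏ a, hh η (u (k.succAbove l)) (u a)) *
        ((∏ a, hh η (w a) (u (k.succAbove l))) * hh η z (u (k.succAbove l))))

open Polynomial in
lemma exists_polynomial_det_minorMatrix (η β : ℂ) {m : ℕ} (w : Fin m → ℂ)
    (u : Fin (m + 1) → ℂ) (k : Fin (m + 1)) :
    ∃ p : ℂ[X], p.natDegree ≤ m ∧ ∀ z, p.eval z = (minorMatrix η β w u k z).det := by
  let a : Matrix (Fin m) (Fin m) ℂ := minorMatrix η β w u k 0
  let b : Matrix (Fin m) (Fin m) ℂ := minorMatrix η β w u k 1 - minorMatrix η β w u k 0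
  refine ⟨((X : ℂ[X]) • b.map C + a.map C).det, ?_, fun z => ?_⟩
  · simpa using natDegree_det_X_add_C_le b a
  · rw [← coe_evalRingHom, RingHom.map_det]
    congr 1
    ext i j
    simp [a, b, minorMatrix, hh]
    ring

lemma det_clearedMatrix_eq_sum (η β : ℂ) {m : ℕ} (v u : Fin (m + 1) → ℂ)
    (hη : η ≠ 0) (huv : ∀ k, u k ≠ v (Fin.last m))
    (h1 : ∀ k, hh η (u k) (v (Fin.last m)) ≠ 0) (h2 : ∀ k, hh η (v (Fin.last m)) (u k) ≠ 0) :
    (clearedMatrix η β v u).det = ∑ k : Fin (m + 1), (-1) ^ (m + (k : ℕ)) *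
      (η / (v (Fin.last m) - u k) * residueCoeff η β (v ∘ Fin.castSucc) u k) *
        (minorMatrix η β (v ∘ Fin.castSucc) u k (v (Fin.last m))).det := by
  rw [Matrix.det_succ_row _ (Fin.last m)]
  refine Finset.sum_congr rfl fun k _ => ?_
  congr 2
  · have e1 := h1 k
    have e2 := h2 k
    have e3 : v (Fin.last m) - u k ≠ 0 := sub_ne_zero.2 (huv k).symm
    have e4 : u k - v (Fin.last m) ≠ 0 := sub_ne_zero.2 (huv k)
    have t1 : tt η (u k) (v (Fin.last m)) * hh η (u k) (v (Fin.last m)) =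
        -(η / (v (Fin.last m) - u k)) := by
      unfold hh at e1 ⊢
      have := (div_ne_zero_iff.1 e1).1
      rw [← neg_sub (u k), div_neg, neg_neg]
      unfold tt
      field_simp
    have t2 : tt η (v (Fin.last m)) (u k) * hh η (v (Fin.last m)) (u k) =
        η / (v (Fin.last m) - u k) := by
      unfold hh at e2 ⊢
      have := (div_ne_zero_iff.1 e2).1
      unfold tt
      field_simp
    simp only [clearedMatrix, residueCoeff, Matrix.of_apply, Function.comp_apply]
    rw [Fin.prod_univ_castSucc (fun a => hh η (u k) (v a)),
      Fin.prod_univ_castSucc (fun a => hh η (v a) (u k))]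
    linear_combination (Complex.exp β * (∏ a, hh η (u a) (u k)) *
      ∏ a : Fin m, hh η (u k) (v a.castSucc)) * t1 +
      ((∏ a, hh η (u k) (u a)) * ∏ a : Fin m, hh η (v a.castSucc) (u k)) * t2
  · ext j l
    simp only [clearedMatrix, minorMatrix, Matrix.of_apply, Matrix.submatrix_apply,
      Function.comp_apply, Fin.succAbove_last]
    rw [Fin.prod_univ_castSucc (fun a => hh η _ (v a)),
      Fin.prod_univ_castSucc (fun a => hh η (v a) _)]

/-- At `z = u_k` the minor reduces to the cleared matrix with `u_k` removed. -/
lemma det_minorMatrix_self (η β : ℂ) {m : ℕ} (w : Fin m → ℂ) (u : Fin (m + 1) → ℂ)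
    (k : Fin (m + 1)) :
    (minorMatrix η β w u k (u k)).det =
      (∏ l, hh η (u (k.succAbove l)) (u k) * hh η (u k) (u (k.succAbove l))) *
        (clearedMatrix η β w (u ∘ k.succAbove)).det := by
  rw [← Matrix.det_mul_row]
  congr 1
  ext j l
  simp only [clearedMatrix, minorMatrix, Matrix.of_apply, Function.comp_apply]
  rw [Fin.prod_univ_succAbove (fun a => hh η (u a) _) k,
    Fin.prod_univ_succAbove (fun a => hh η _ (u a)) k]
  ring

/-- The pole expansion of the cleared determinant in the last variable `v_N`. -/
lemma det_clearedMatrix_recursion (η β : ℂ) {m : ℕ} (v u : Fin (m + 1) → ℂ) (hη : η ≠ 0)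
    (hu : Function.Injective u) (hv : Function.Injective v) (huv : ∀ j k, u k ≠ v j)
    (h1 : ∀ j k, hh η (u k) (v j) ≠ 0) (h2 : ∀ j k, hh η (v j) (u k) ≠ 0) :
    (clearedMatrix η β v u).det = ∑ k : Fin (m + 1), (-1) ^ (m + (k : ℕ)) *
      (η / (v (Fin.last m) - u k) * residueCoeff η β (v ∘ Fin.castSucc) u k) *
        (minorMatrix η β (v ∘ Fin.castSucc) u k (u k)).det *
        ∏ a : Fin m, (v (Fin.last m) - v a.castSucc) / (u k - v a.castSucc) := by
  choose p hp hpe using exists_polynomial_det_minorMatrix η β (v ∘ Fin.castSucc) u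
  let P : Fin (m + 1) → Polynomial ℂ := fun k =>
    Polynomial.C ((-1) ^ (m + (k : ℕ)) * η * residueCoeff η β (v ∘ Fin.castSucc) u k) * p k
  have hterm : ∀ x k y, (P k).eval y / (x - u k) = (-1) ^ (m + (k : ℕ)) *
      (η / (x - u k) * residueCoeff η β (v ∘ Fin.castSucc) u k) *
        (minorMatrix η β (v ∘ Fin.castSucc) u k y).det := by
    intro x k y
    simp only [P, Polynomial.eval_mul, Polynomial.eval_C, hpe]
    ring
  have key := sum_eval_div_eq_sum_residues u (v ∘ Fin.castSucc) hu
    (hv.comp (Fin.castSucc_injective m)) (fun a k => huv _ k) P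
    (fun k => (Polynomial.natDegree_C_mul_le _ _).trans (hp k)) ?_ (v (Fin.last m))
    (fun k => (huv _ k).symm)
  · simp only [hterm] at key
    rw [det_clearedMatrix_eq_sum η β v u hη (huv _) (h1 _) (h2 _), key]
    rfl
  · intro a
    let v' : Fin (m + 1) → ℂ := Fin.snoc (v ∘ Fin.castSucc) (v a.castSucc)
    have hlast : v' (Fin.last m) = v a.castSucc := Fin.snoc_last _ _
    have hcomp : v' ∘ Fin.castSucc = v ∘ Fin.castSucc := by
      ext i; exact Fin.snoc_castSucc (α := fun _ => ℂ) _ _ _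
    have hexp := det_clearedMatrix_eq_sum η β v' u hη (by rw [hlast]; exact huv _)
      (by rw [hlast]; exact h1 _) (by rw [hlast]; exact h2 _)
    rw [hlast, hcomp] at hexp
    simp only [hterm, Function.comp_apply]
    rw [← hexp]
    refine Matrix.det_zero_of_row_eq (Fin.castSucc_lt_last a).ne ?_
    have : v' a.castSucc = v' (Fin.last m) := by
      rw [hlast]; exact congrFun hcomp a
    ext k
    simp only [clearedMatrix, Matrix.of_apply, this]

/-- the recursion for `Φ_N` obtained by expanding over the poles at
`v_N = u_j`. -/
theorem stmt5 (η β : ℂ) (hη : η ≠ 0) (n : ℕ) (v u : Fin (n + 2) → ℂ)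
    (hu : Function.Injective u) (hv : Function.Injective v)
    (huv : ∀ j k, u k ≠ v j)
    (huη : ∀ a b, a ≠ b → u a - u b ≠ η ∧ u a - u b ≠ -η)
    (huvη : ∀ j k, u k - v j ≠ η ∧ u k - v j ≠ -η) :
    Phi η β (n + 2) v u =
      ∑ j : Fin (n + 2),
        gg η (v (Fin.last (n + 1))) (u j) *
          ((∏ k : Fin (n + 1), ff η (u j) (u (j.succAbove k))) *
              (∏ k : Fin (n + 1), ff η (v k.castSucc) (u j)) -
            Complex.exp β * (∏ k : Fin (n + 1), ff η (u (j.succAbove k)) (u j)) *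
              (∏ k : Fin (n + 1), ff η (u j) (v k.castSucc))) *
          Phi η β (n + 1) (v ∘ Fin.castSucc) (u ∘ j.succAbove) := by
  have huu : ∀ a b, hh η (u a) (u b) ≠ 0 := by
    intro a b
    rcases eq_or_ne a b with rfl | hab
    · rw [hh_self hη]; exact one_ne_zero
    · exact div_ne_zero (fun h => (huη a b hab).2 (by linear_combination h)) hη
  have h1 : ∀ j k, hh η (u k) (v j) ≠ 0 := fun j k =>
    div_ne_zero (fun h => (huvη j k).2 (by linear_combination h)) hη
  have h2 : ∀ j k, hh η (v j) (u k) ≠ 0 := fun j k =>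
    div_ne_zero (fun h => (huvη j k).1 (by linear_combination -h)) hη
  have hf : ∀ x y, ff η x y = hh η x y * gg η x y := fun x y => by
    unfold ff hh gg; field_simp
  have hneg : ∀ x y, gg η x y = -1 * gg η y x := fun x y => by
    unfold gg; rw [← neg_sub y x, div_neg, neg_one_mul]
  rw [Phi_eq_det_clearedMatrix η β v u huu fun a b => h1 b a,
    det_clearedMatrix_recursion η β v u hη hu hv huv h1 h2, Finset.mul_sum]
  refine Finset.sum_congr rfl fun k _ => ?_
  rw [Phi_eq_det_clearedMatrix η β (v ∘ Fin.castSucc) (u ∘ k.succAbove)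
      (fun a b => huu _ _) (fun a b => h1 _ _), Delta_succAbove η u k, Delta'_castSucc,
    det_minorMatrix_self]
  have hden : ∏ l, ∏ a, hh η (u a) (u l) =
      (∏ l, hh η (u (k.succAbove l)) (u k) * hh η (u k) (u (k.succAbove l))) *
        ∏ l, ∏ a, hh η ((u ∘ k.succAbove) a) ((u ∘ k.succAbove) l) := by
    simp only [Fin.prod_univ_succAbove _ k, hh_self hη, Finset.prod_mul_distrib,
      Function.comp_apply, one_mul]
    ring
  have hB : (∏ l, hh η (u (k.succAbove l)) (u k) * hh η (u k) (u (k.succAbove l))) ≠ 0 :=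
    Finset.prod_ne_zero_iff.2 fun l _ => mul_ne_zero (huu _ _) (huu _ _)
  have hB' : (∏ l, ∏ a, hh η ((u ∘ k.succAbove) a) ((u ∘ k.succAbove) l)) ≠ 0 :=
    Finset.prod_ne_zero_iff.2 fun l _ => Finset.prod_ne_zero_iff.2 fun a _ => huu _ _
  have hsq : ((-1 : ℂ) ^ (n + 1 + (k : ℕ))) * (-1) ^ (n + 1 + (k : ℕ)) = 1 := by
    rw [← mul_pow]; simp
  have hshift : (∏ a : Fin (n + 1), gg η (v a.castSucc) (v (Fin.last (n + 1)))) *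
      ∏ a : Fin (n + 1), (v (Fin.last (n + 1)) - v a.castSucc) / (u k - v a.castSucc) =
      ∏ a : Fin (n + 1), gg η (v a.castSucc) (u k) := by
    rw [← Finset.prod_mul_distrib]
    refine Finset.prod_congr rfl fun a _ => ?_
    have e1 : v (Fin.last (n + 1)) - v a.castSucc ≠ 0 :=
      sub_ne_zero.2 fun h => (Fin.castSucc_lt_last a).ne (hv h).symm
    have e2 : u k - v a.castSucc ≠ 0 := sub_ne_zero.2 (huv _ k)
    unfold gg
    rw [← neg_sub (v (Fin.last (n + 1))), ← neg_sub (u k), div_neg, div_neg]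
    field_simp
  have hcoef : (∏ l, ff η (u k) (u (k.succAbove l))) *
        (∏ a : Fin (n + 1), ff η (v a.castSucc) (u k)) -
      Complex.exp β * (∏ l, ff η (u (k.succAbove l)) (u k)) *
        (∏ a : Fin (n + 1), ff η (u k) (v a.castSucc)) =
      residueCoeff η β (v ∘ Fin.castSucc) u k * (∏ l, gg η (u k) (u (k.succAbove l))) *
        ∏ a : Fin (n + 1), gg η (v a.castSucc) (u k) := by
    have s1 : ∏ l, gg η (u (k.succAbove l)) (u k) =
        (-1) ^ (n + 1) * ∏ l, gg η (u k) (u (k.succAbove l)) := by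
      simp only [hneg (u (k.succAbove _)), Finset.prod_mul_distrib, Finset.prod_const,
        Finset.card_univ, Fintype.card_fin]
    have s2 : ∏ a : Fin (n + 1), gg η (u k) (v a.castSucc) =
        (-1) ^ (n + 1) * ∏ a : Fin (n + 1), gg η (v a.castSucc) (u k) := by
      simp only [hneg (u k), Finset.prod_mul_distrib, Finset.prod_const,
        Finset.card_univ, Fintype.card_fin]
    have s3 : ((-1 : ℂ) ^ (n + 1)) * (-1) ^ (n + 1) = 1 := by
      rw [← mul_pow]; simp
    simp only [hf, Finset.prod_mul_distrib, residueCoeff, Function.comp_apply]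
    rw [s1, s2, Fin.prod_univ_succAbove (fun a => hh η (u k) (u a)) k,
      Fin.prod_univ_succAbove (fun a => hh η (u a) (u k)) k, hh_self hη]
    linear_combination (-(Complex.exp β * (∏ l, hh η (u (k.succAbove l)) (u k)) *
      (∏ l, gg η (u k) (u (k.succAbove l))) * (∏ a : Fin (n + 1), hh η (u k) (v a.castSucc)) *
      ∏ a : Fin (n + 1), gg η (v a.castSucc) (u k))) * s3
  rw [hcoef, hden, ← hshift]
  generalize (∏ l, hh η (u (k.succAbove l)) (u k) * hh η (u k) (u (k.succAbove l))) = B at *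
  generalize (∏ l, ∏ a, hh η ((u ∘ k.succAbove) a) ((u ∘ k.succAbove) l)) = B' at *
  generalize ((-1 : ℂ) ^ (n + 1 + (k : ℕ))) = s at *
  rw [show gg η (v (Fin.last (n + 1))) (u k) = η / (v (Fin.last (n + 1)) - u k) from rfl]
  generalize (∏ a : Fin (n + 1), (v (Fin.last (n + 1)) - v a.castSucc) / (u k - v a.castSucc)) = p
  generalize η / (v (Fin.last (n + 1)) - u k) = q
  generalize (∏ a : Fin (n + 1), gg η (v a.castSucc) (v (Fin.last (n + 1)))) = r
  generalize (∏ l, gg η (u k) (u (k.succAbove l))) = r'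
  field_simp
  linear_combination (q * p * r * r' * Delta' η (v ∘ Fin.castSucc) * Delta η (u ∘ k.succAbove) *
    residueCoeff η β (v ∘ Fin.castSucc) u k *
    (clearedMatrix η β (v ∘ Fin.castSucc) (u ∘ k.succAbove)).det) * hsq
end
end

section
/- Let η ≠ 0, β ∈ ℂ, N ≥ 2, and let v̄ = (v_1,…,v_N), ū = (u_1,…,u_N) be tuples of complex numbers such that u_2 = u_1 + η, the u_j are pairwise distinct, and u_k − v_j ∉ {0, η, −η} for all j, k. Define the N×N matrix N_{jk} = e^β t(u_k,v_j) h(ū,u_k) + t(v_j,u_k) · h(u_k,ū) h(v̄,u_k) / h(u_k,v̄). Then det_N N = 0. (Consequently the scalar product function 𝔽^J_N(v̄,ū|β) = det_N N /(h(ū,ū))·Δ'(v̄)Δ(ū)h(ū,v̄), is not singular at points where h(u_a,u_b) = 0: its first and second columns become proportional there.) -/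
open Finset

noncomputable section

/-- A square matrix with two columns proportional to a common vector is singular. -/
theorem det_eq_zero_of_cols_proportional {ι K : Type*} [Fintype ι] [DecidableEq ι] [Field K]
    (M : Matrix ι ι K) {p q : ι} (hpq : p ≠ q) (a c : K) (w : ι → K)
    (hp : ∀ j, M j p = a * w j) (hq : ∀ j, M j q = c * w j) : M.det = 0 := by
  by_cases ha : a = 0
  · exact Matrix.det_eq_zero_of_column_eq_zero p fun j => by rw [hp, ha, zero_mul]
  · refine Matrix.exists_mulVec_eq_zero_iff.mp ⟨Pi.single p c - Pi.single q a, ?_, ?_⟩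
    · intro h
      have hx := congrFun h q
      simp [hpq.symm] at hx
      exact ha hx
    · ext j
      simp only [Matrix.mulVec_sub, Matrix.mulVec_single, Pi.sub_apply, Pi.smul_apply,
        Matrix.col_apply, MulOpposite.smul_eq_mul_unop, MulOpposite.unop_op, Pi.zero_apply, hp, hq]
      ring

/-- `h(u, u + η) = 0` -/
theorem hh_self_add (η x : ℂ) : hh η x (x + η) = 0 := by
  simp [hh]

/-- `t(v, u + η) = t(u, v)` -/
theorem tt_add_right (η x y : ℂ) : tt η y (x + η) = tt η x y := by
  unfold tt
  congr 1
  ring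

/-- when `u_2 = u_1 + η`, the determinant of the matrix
`N_{jk} = e^β t(u_k,v_j) h(ū,u_k) + t(v_j,u_k) h(u_k,ū) h(v̄,u_k)/h(u_k,v̄)` vanishes
(its first two columns are proportional). -/
theorem stmt7 (η β : ℂ) (hη : η ≠ 0) (n : ℕ) (v u : Fin (n + 2) → ℂ)
    (hu2 : u 1 = u 0 + η) (hu : Function.Injective u)
    (huv : ∀ j k, u k - v j ≠ 0 ∧ u k - v j ≠ η ∧ u k - v j ≠ -η) :
    Matrix.det (Matrix.of fun j k : Fin (n + 2) =>
      Complex.exp β * tt η (u k) (v j) * (∏ a, hh η (u a) (u k)) +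
        tt η (v j) (u k) * (∏ a, hh η (u k) (u a)) * (∏ a, hh η (v a) (u k)) /
          (∏ a, hh η (u k) (v a))) = 0 := by
  have h01 : hh η (u 0) (u 1) = 0 := by rw [hu2, hh_self_add]
  have hrow : ∏ a, hh η (u 0) (u a) = 0 := prod_eq_zero (mem_univ 1) h01
  have hcol : ∏ a, hh η (u a) (u 1) = 0 := prod_eq_zero (mem_univ 0) h01
  refine det_eq_zero_of_cols_proportional _ (p := 0) (q := 1) (by simp)
    (Complex.exp β * ∏ a, hh η (u a) (u 0))
    ((∏ a, hh η (u 1) (u a)) * (∏ a, hh η (v a) (u 1)) / ∏ a, hh η (u 1) (v a))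
    (fun j => tt η (u 0) (v j)) (fun j => ?_) (fun j => ?_)
  · rw [Matrix.of_apply, hrow]
    ring
  · have ht : tt η (v j) (u 1) = tt η (u 0) (v j) := by rw [hu2, tt_add_right]
    rw [Matrix.of_apply, hcol, ht]
    ring
end
end

section
/- Let n ≥ 1, let u_1,…,u_n be pairwise distinct complex numbers, and let v_1,…,v_n be arbitrary complex numbers. Then Σ_{k=1}^{n} [ Π_{j=1}^{n}(u_k − v_j) ] / [ Π_{j=1, j≠k}^{n}(u_k − u_j) ] = Σ_{j=1}^{n} (u_j − v_j). -/
open Finset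

/-- `Σ_k Π_j(u_k−v_j) / Π_{j≠k}(u_k−u_j) = Σ_j (u_j−v_j)` for pairwise
distinct `u_1,…,u_n`. -/
theorem stmt12 (n : ℕ) (hn : 1 ≤ n) (u v : Fin n → ℂ) (hu : Function.Injective u) :
    ∑ k : Fin n, (∏ j, (u k - v j)) / (∏ j ∈ Finset.univ.erase k, (u k - u j))
      = ∑ j, (u j - v j) := by
  have hcard : #(univ : Finset (Fin n)) = n := by simp
  have hpos : 0 < #(univ : Finset (Fin n)) := by omega
  have hdeg : (Lagrange.nodal univ v - Lagrange.nodal univ u).degree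
      < #(univ : Finset (Fin n)) := by
    rw [← Lagrange.degree_nodal (v := v)]
    refine Polynomial.degree_sub_lt_left ?_ Lagrange.nodal_ne_zero ?_
    · rw [Lagrange.degree_nodal, Lagrange.degree_nodal]
    · rw [Lagrange.nodal_monic.leadingCoeff, Lagrange.nodal_monic.leadingCoeff]
  have hcoeff := Lagrange.coeff_eq_sum hu.injOn hdeg
  rw [Polynomial.coeff_sub, Lagrange.nodal, Lagrange.nodal,
    Polynomial.prod_X_sub_C_coeff_card_pred _ _ hpos,
    Polynomial.prod_X_sub_C_coeff_card_pred _ _ hpos, ← Lagrange.nodal, ← Lagrange.nodal,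
    neg_sub_neg, ← sum_sub_distrib] at hcoeff
  rw [hcoeff]
  refine sum_congr rfl fun k hk => ?_
  rw [Polynomial.eval_sub, Lagrange.eval_nodal_at_node hk, sub_zero, Lagrange.eval_nodal]
end

section
/- Let n ≥ 1 be an integer, β ∈ ℂ, and let s ∈ ℂ not be an integer. Then Σ_{k=0}^{n−1} e^{kβ} · binom(n−1,k) · Γ(k+1−s) · Γ(n−1+s−k) = ((n−1)! · π / sin(πs)) · Σ_{k=0}^{n−1} [ (1−s)_k (1−n)_k / ( (1)_k · k! ) ] · (1 − e^β)^k, where Γ is the complex Gamma function and (x)_k = x(x+1)⋯(x+k−1) is the Pochhammer symbol ((x)_0 = 1). (The right-hand side is (n−1)!·π/sin(πs) times the terminating Gauss hypergeometric series ₂F₁(1−s, 1−n; 1; 1−e^β).) -/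
open Finset

noncomputable section

theorem ascPochhammer_succ_left_eval {R : Type*} [CommSemiring R] (k : ℕ) (a : R) :
    (ascPochhammer R (k + 1)).eval a = a * (ascPochhammer R k).eval (a + 1) := by
  simp [ascPochhammer_succ_left]

/-- A homogeneous form of the transformation of terminating hypergeometric series between the
arguments `x` and `1 - x`. At `x = 1` it is the Chu–Vandermonde identity. -/
theorem sum_choose_mul_ascPochhammer_mul_pow {R : Type*} [CommRing R] (x : R) (N : ℕ) (a b : R) :
    ∑ k ∈ range (N + 1), (N.choose k : R) *
        (x ^ k * (ascPochhammer R k).eval a * (ascPochhammer R (N - k)).eval b) =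
      ∑ k ∈ range (N + 1), (N.choose k : R) *
        ((ascPochhammer R k).eval a * (ascPochhammer R (N - k)).eval (a + b + k) *
          (x - 1) ^ k) := by
  induction N generalizing a b with
  | zero => simp
  | succ N ih =>
    have hx := ih (a + 1) b
    have hy := ih a (b + 1)
    rw [sum_choose_succ_mul (fun i j => x ^ i * (ascPochhammer R i).eval a *
        (ascPochhammer R j).eval b),
      sum_choose_succ_mul (fun i j => (ascPochhammer R i).eval a *
        (ascPochhammer R j).eval (a + b + i) * (x - 1) ^ i)]
    have hl : ∑ k ∈ range (N + 1), (N.choose k : R) *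
          (x ^ k * (ascPochhammer R k).eval a * (ascPochhammer R (N + 1 - k)).eval b) =
        b * ∑ k ∈ range (N + 1), (N.choose k : R) *
          (x ^ k * (ascPochhammer R k).eval a * (ascPochhammer R (N - k)).eval (b + 1)) := by
      rw [mul_sum]
      refine sum_congr rfl fun k hk => ?_
      rw [Nat.succ_sub (mem_range_succ_iff.mp hk), Nat.succ_eq_add_one,
        ascPochhammer_succ_left_eval]
      ring
    have hr : ∑ k ∈ range (N + 1), (N.choose k : R) *
          (x ^ (k + 1) * (ascPochhammer R (k + 1)).eval a * (ascPochhammer R (N - k)).eval b) =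
        a * x * ∑ k ∈ range (N + 1), (N.choose k : R) *
          (x ^ k * (ascPochhammer R k).eval (a + 1) * (ascPochhammer R (N - k)).eval b) := by
      rw [mul_sum]
      refine sum_congr rfl fun k _ => ?_
      rw [ascPochhammer_succ_left_eval]
      ring
    rw [hl, hr, hx, hy, mul_sum, mul_sum, ← sum_add_distrib, ← sum_add_distrib]
    refine sum_congr rfl fun k hk => ?_
    have h₁ := ascPochhammer_succ_left_eval k a
    have h₂ := ascPochhammer_succ_eval k a
    rw [Nat.succ_sub (mem_range_succ_iff.mp hk), Nat.succ_eq_add_one,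
      ascPochhammer_succ_left_eval (N - k) (a + b + k), h₁]
    rw [h₁] at h₂
    have e₁ : a + (b + 1) + (k : R) = a + b + k + 1 := by ring
    have e₂ : a + 1 + b + (k : R) = a + b + k + 1 := by ring
    have e₃ : a + b + ((k + 1 : ℕ) : R) = a + b + k + 1 := by push_cast; ring
    rw [e₁, e₂, e₃]
    linear_combination (N.choose k : R) *
      (ascPochhammer R (N - k)).eval (a + b + k + 1) * (x - 1) ^ k * h₂

/-- `Σ_{k=0}^{n−1} e^{kβ} binom(n−1,k) Γ(k+1−s) Γ(n−1+s−k)` equals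
`((n−1)! π/sin(πs))` times the terminating hypergeometric series `₂F₁(1−s,1−n;1;1−e^β)`. -/
theorem stmt16 (n : ℕ) (hn : 1 ≤ n) (β s : ℂ) (hs : ∀ m : ℤ, s ≠ m) :
    ∑ k ∈ Finset.range n,
        Complex.exp β ^ k * ((n - 1).choose k : ℂ) *
          Complex.Gamma ((k : ℂ) + 1 - s) * Complex.Gamma ((n : ℂ) - 1 + s - k)
      = (Nat.factorial (n - 1) : ℂ) * (Real.pi : ℂ) / Complex.sin ((Real.pi : ℂ) * s) *
          ∑ k ∈ Finset.range n,
            (ascPochhammer ℂ k).eval (1 - s) * (ascPochhammer ℂ k).eval (1 - (n : ℂ)) /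
                ((ascPochhammer ℂ k).eval 1 * (Nat.factorial k : ℂ)) *
              (1 - Complex.exp β) ^ k := by
  obtain ⟨N, rfl⟩ : ∃ N, n = N + 1 := ⟨n - 1, by omega⟩
  have hs₀ : ∀ m : ℕ, s ≠ -m := fun m h => hs (-m) (by simpa using h)
  have hs₁ : ∀ m : ℕ, 1 - s ≠ -m := fun m h => hs (m + 1) (by
    push_cast
    linear_combination -h)
  have hl : ∀ k ∈ range (N + 1), Complex.exp β ^ k * (N.choose k : ℂ) *
      Complex.Gamma ((k : ℂ) + 1 - s) * Complex.Gamma (((N + 1 : ℕ) : ℂ) - 1 + s - k) =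
      Real.pi / Complex.sin (Real.pi * s) * ((N.choose k : ℂ) * (Complex.exp β ^ k *
        (ascPochhammer ℂ k).eval (1 - s) * (ascPochhammer ℂ (N - k)).eval s)) := by
    intro k hk
    have g₀ := Complex.Gamma_ne_zero hs₀
    have g₁ := Complex.Gamma_ne_zero hs₁
    rw [← Complex.Gamma_mul_Gamma_one_sub, ← Complex.Gamma_add_nat_div_Gamma_eq (1 - s) hs₁,
      ← Complex.Gamma_add_nat_div_Gamma_eq s hs₀, Nat.cast_sub (mem_range_succ_iff.mp hk),
      show (k : ℂ) + 1 - s = 1 - s + k by ring,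
      show ((N + 1 : ℕ) : ℂ) - 1 + s - k = s + (N - k) by push_cast; ring]
    field_simp
  simp only [Nat.add_sub_cancel]
  rw [sum_congr rfl hl, ← mul_sum, sum_choose_mul_ascPochhammer_mul_pow, mul_div_assoc,
    mul_comm (N.factorial : ℂ), mul_assoc]
  congr 1
  rw [mul_sum]
  refine sum_congr rfl fun k hk => ?_
  have hk : k ≤ N := mem_range_succ_iff.mp hk
  have hk₀ : (k.factorial : ℂ) ≠ 0 := Nat.cast_ne_zero.mpr k.factorial_ne_zero
  have hrise := factorial_mul_ascPochhammer ℂ k (N - k)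
  rw [Nat.add_sub_cancel' hk] at hrise
  have hfall : (N.descFactorial k : ℂ) = k.factorial * N.choose k := by
    exact_mod_cast Nat.descFactorial_eq_factorial_mul_choose N k
  rw [show 1 - ((N + 1 : ℕ) : ℂ) = -N by push_cast; ring,
    ascPochhammer_eval_neg_eq_descPochhammer, descPochhammer_eval_eq_descFactorial, hfall,
    ascPochhammer_eval_one, ← hrise, show 1 - s + s + (k : ℂ) = k + 1 by ring,
    ← neg_sub 1 (Complex.exp β), neg_pow (1 - Complex.exp β)]
  field_simp
end
end
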